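/- Let I ⊂ S be a monomial ideal. If S/I is Cohen–Macaulay, then S/I has maximal depth with respect to P and maximal depth with respect to Q. -/

import Mathlib

open CategoryTheory MvPolynomial

noncomputable section

/-- The standard bigraded polynomial ring `S = K[x_1,…,x_m, y_1,…,y_n]`. -/
abbrev BGS (K : Type) [Field K] (m n : ℕ) : Type := MvPolynomial (Fin m ⊕ Fin n) K

/-- The bigrading weights: `deg x_i = (1,0)`, `deg y_j = (0,1)`. -/
def bwt (m n : ℕ) : Fin m ⊕ Fin n → ℕ × ℕ := Sum.elim (fun _ => (1, 0)) (fun _ => (0, 1))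

/-- `P = (x_1, …, x_m)`. -/
def idealP (K : Type) [Field K] (m n : ℕ) : Ideal (BGS K m n) :=
  Ideal.span (Set.range fun i : Fin m => (X (Sum.inl i) : BGS K m n))

/-- `Q = (y_1, …, y_n)`. -/
def idealQ (K : Type) [Field K] (m n : ℕ) : Ideal (BGS K m n) :=
  Ideal.span (Set.range fun j : Fin n => (X (Sum.inr j) : BGS K m n))

/-- `cd(J, M)`: the cohomological dimension, i.e. the largest `i` such that the local
cohomology module `H^i_J(M)` is nonzero. -/
def cohDim (R : Type) [CommRing R] (J : Ideal R) (M : Type) [AddCommGroup M] [Module R M] : ℕ :=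
  sSup {i : ℕ | Nontrivial ((localCohomology J i).obj (ModuleCat.of R M))}

/-- `grade(J, M)`: the least `i` with `Ext^i(R/J, M) ≠ 0`. -/
def extGrade (R : Type) [CommRing R] (J : Ideal R) (M : Type) [AddCommGroup M] [Module R M] : ℕ :=
  sInf {i : ℕ | Nontrivial
    (((Ext R (ModuleCat R) i).obj (Opposite.op (ModuleCat.of R (R ⧸ J)))).obj (ModuleCat.of R M))}

/-- `mgrade(J, M) = min {cd(J, R/p) : p ∈ Ass(M)}`. -/
def mCohDim (R : Type) [CommRing R] (J : Ideal R) (M : Type) [AddCommGroup M] [Module R M] : ℕ :=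
  sInf ((fun p => cohDim R J (R ⧸ p)) '' associatedPrimes R M)

/-- `M` has maximal depth with respect to `J` if `grade(J, M) = mgrade(J, M)`. -/
def HasMaximalDepth (R : Type) [CommRing R] (J : Ideal R) (M : Type) [AddCommGroup M]
    [Module R M] : Prop :=
  extGrade R J M = mCohDim R J M

/-- A bigrading on an `S`-module `M`: an internal direct sum decomposition indexed by `ℕ × ℕ`
compatible with the bigrading of `S`. -/
structure IsBigrading (K : Type) [Field K] (m n : ℕ) (M : Type) [AddCommGroup M]
    [Module (BGS K m n) M] (ℳ : ℕ × ℕ → AddSubgroup M) : Prop where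
  internal : DirectSum.IsInternal ℳ
  smul_mem : ∀ (d e : ℕ × ℕ) (s : BGS K m n) (x : M),
    IsWeightedHomogeneous (bwt m n) s d → x ∈ ℳ e → s • x ∈ ℳ (d + e)

/-- A submodule is bigraded if it is generated by bihomogeneous elements. -/
def IsBigradedSubmodule (K : Type) [Field K] (m n : ℕ) {M : Type} [AddCommGroup M]
    [Module (BGS K m n) M] (ℳ : ℕ × ℕ → AddSubgroup M) (N : Submodule (BGS K m n) M) : Prop :=
  N = Submodule.span (BGS K m n) {x : M | x ∈ N ∧ ∃ d, x ∈ ℳ d}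

/-- `I` is a monomial ideal. -/
def IsMonomialIdeal (K : Type) [Field K] (m n : ℕ) (I : Ideal (BGS K m n)) : Prop :=
  ∃ T : Set ((Fin m ⊕ Fin n) →₀ ℕ),
    I = Ideal.span ((fun d => (monomial d (1 : K) : BGS K m n)) '' T)


section comparison
universe u
variable {R : Type} [CommRing R]

/-- The map of Hom complexes induced by a chain map. -/
def yonedaMap {P Q : ChainComplex (ModuleCat.{0} R) ℕ} (φ : P ⟶ Q) (N : ModuleCat.{0} R) :
    Q.linearYonedaObj R N ⟶ P.linearYonedaObj R N where
  f i := (((((linearYoneda R (ModuleCat.{0} R)).obj N).rightOp.mapHomologicalComplex _).map φ).f i).unop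
  comm' i j _ := by
    have := ((((linearYoneda R (ModuleCat.{0} R)).obj N).rightOp.mapHomologicalComplex _).map φ).comm j i
    exact congrArg Quiver.Hom.unop this.symm

lemma iso_square {V : Type*} [Category V] {A B A' B' : V} {i : A ≅ A'} {j : B ≅ B'} {f : A ⟶ B}
    {g : A' ⟶ B'} (h : f ≫ j.hom = i.hom ≫ g) : g ≫ j.inv = i.inv ≫ f := by
  rw [Iso.comp_inv_eq, Category.assoc, h, Iso.inv_hom_id_assoc]

lemma homologyOp_inv_nat {V : Type*} [Category V] [Abelian V] {ι : Type*} {c : ComplexShape ι}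
    {K L : HomologicalComplex V c} (ψ : K ⟶ L) (n : ι) :
    (HomologicalComplex.homologyMap ψ n).op ≫ (K.homologyOp n).inv =
      (L.homologyOp n).inv ≫ HomologicalComplex.homologyMap
        ((HomologicalComplex.opFunctor _ _).map ψ.op) n := by
  exact iso_square (HomologicalComplex.homologyOp_hom_naturality ψ n)

lemma paste_squares {V : Type*} [Category V] {A B C A' B' C' : V} {a : A ⟶ A'} {p₁ : A' ⟶ B'}
    {p₂ : B' ⟶ C'} {q₁ : A ⟶ B} {q₂ : B ⟶ C} {h : B ⟶ B'} {k : C ⟶ C'}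
    (h₁ : a ≫ p₁ = q₁ ≫ h) (h₂ : h ≫ p₂ = q₂ ≫ k) : a ≫ p₁ ≫ p₂ = (q₁ ≫ q₂) ≫ k := by
  rw [← Category.assoc, h₁, Category.assoc, h₂, Category.assoc]

lemma isoExt_naturality {X Y : ModuleCat.{0} R} (f : X ⟶ Y) (P : ProjectiveResolution X)
    (Q : ProjectiveResolution Y) (φ : ProjectiveResolution.Hom P Q f) (N : ModuleCat.{0} R) (n : ℕ) :
    ((Ext R (ModuleCat.{0} R) n).map f.op).app N ≫ (P.isoExt n N).hom =
      (Q.isoExt n N).hom ≫ HomologicalComplex.homologyMap (yonedaMap φ.hom N) n := by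
  have h1 := ProjectiveResolution.isoLeftDerivedObj_inv_naturality f P Q φ.hom
    (by simpa using φ.hom_f_zero_comp_π_f_zero) ((linearYoneda R (ModuleCat.{0} R)).obj N).rightOp n
  have h2 := homologyOp_inv_nat (yonedaMap φ.hom N) n
  exact paste_squares (congrArg Quiver.Hom.unop h1) (congrArg Quiver.Hom.unop h2).symm

end comparison
section rep
variable {R : Type} [CommRing R]
def HRep (K : CochainComplex (ModuleCat.{0} R) ℕ) (n : ℕ) (x : K.X n) (e : K.homology n) : Prop :=
  ∃ z : K.cycles n, (K.iCycles n).hom z = x ∧ (K.homologyπ n).hom z = e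

lemma HRep.exists_rep (K : CochainComplex (ModuleCat.{0} R) ℕ) (n : ℕ) (e : K.homology n) :
    ∃ x, (K.d n (n+1)).hom x = 0 ∧ HRep K n x e := by
  obtain ⟨z, rfl⟩ := (ModuleCat.epi_iff_surjective (K.homologyπ n)).1 inferInstance e
  refine ⟨_, ?_, z, rfl, rfl⟩
  have := K.iCycles_d n (n+1)
  exact congrArg (fun f => f.hom z) this

lemma HRep.of_cocycle (K : CochainComplex (ModuleCat.{0} R) ℕ) (n : ℕ) (x : K.X n)
    (hx : (K.d n (n+1)).hom x = 0) : ∃ e, HRep K n x e := by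
  let f : ModuleCat.of R R ⟶ K.X n := ModuleCat.ofHom (LinearMap.toSpanSingleton R _ x)
  have hf : f ≫ K.d n (n+1) = 0 := by
    ext
    simpa [f] using hx
  refine ⟨_, (K.liftCycles f (n+1) (by simp) hf).hom (1:R), ?_, rfl⟩
  have := K.liftCycles_i f (n+1) (by simp) hf
  have h2 := congrArg (fun f => f.hom (1:R)) this
  refine h2.trans ?_
  simp [f]

lemma HRep.eq_zero_iff {K : CochainComplex (ModuleCat.{0} R) ℕ} {n : ℕ} {x : K.X n}
   {e : K.homology n} (h : HRep K n x e) :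
    e = 0 ↔ ∃ p, ∃ y : K.X p, (K.d p n).hom y = x := by
  obtain ⟨z, rfl, rfl⟩ := h
  have hinj : Function.Injective (K.iCycles n).hom := (ModuleCat.mono_iff_injective _).1 inferInstance
  constructor
  · intro h
    let c := ShortComplex.mk (K.toCycles _ n) (K.homologyπ n) (K.toCycles_comp_homologyπ ((ComplexShape.up ℕ).prev n) n)
    have hc : c.Exact := ShortComplex.exact_of_g_is_cokernel _ (K.homologyIsCokernel _ n rfl)
    obtain ⟨y, hy⟩ := (ShortComplex.moduleCat_exact_iff c).1 hc z h
    refine ⟨_, y, ?_⟩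
    rw [← hy]
    exact (congrArg (fun f => f.hom y) (K.toCycles_i _ n)).symm
  · rintro ⟨p, y, hy⟩
    have : z = (K.toCycles p n).hom y := by
      apply hinj
      rw [← hy]
      exact (congrArg (fun f => f.hom y) (K.toCycles_i _ n)).symm
    rw [this]
    exact congrArg (fun f => f.hom y) (K.toCycles_comp_homologyπ p n)

lemma HRep.map {K L : CochainComplex (ModuleCat.{0} R) ℕ} (φ : K ⟶ L) {n : ℕ} {x : K.X n}
   {e : K.homology n} (h : HRep K n x e) :
    HRep L n ((φ.f n).hom x) ((HomologicalComplex.homologyMap φ n).hom e) := by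
  obtain ⟨z, rfl, rfl⟩ := h
  refine ⟨(HomologicalComplex.cyclesMap φ n).hom z, ?_, ?_⟩
  · exact congrArg (fun f => f.hom z) (HomologicalComplex.cyclesMap_i φ n)
  · exact (congrArg (fun f => f.hom z) (HomologicalComplex.homologyπ_naturality φ n)).symm
end rep

section newext
variable {R : Type} [CommRing R] {A N : ModuleCat.{0} R}
lemma extMk_eq_zero_iff' (P : ProjectiveResolution A) (n : ℕ) (f : P.complex.X n ⟶ N)
    (hf : P.complex.d (n+1) n ≫ f = 0) :
    P.extMk f (n+1) rfl hf = 0 ↔ ∃ p, ∃ g : P.complex.X p ⟶ N, P.complex.d n p ≫ g = f := by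
  cases n with
  | succ n =>
    rw [P.extMk_eq_zero_iff f _ rfl hf n rfl]
    constructor
    · rintro ⟨g, h⟩; exact ⟨n, g, h⟩
    · rintro ⟨p, g, h⟩
      by_cases hp : p = n
      · subst hp; exact ⟨g, h⟩
      · rw [P.complex.shape _ _ (by simp; exact hp)] at h
        exact ⟨0, by simpa using h⟩
  | zero =>
    simp only [← P.extEquivCohomologyClass.apply_eq_iff_eq,
    P.extEquivCohomologyClass_extMk, P.extEquivCohomologyClass_zero,
    CochainComplex.HomComplex.CohomologyClass.mk_eq_zero_iff]
    rw [CochainComplex.HomComplex.Cocycle.toSingleMk_mem_coboundaries_iff _ _ _ _ _ 1 (by lia)]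
    have h0 : Limits.IsZero (P.cochainComplex.X 1) := P.cochainComplex.isZero_of_isStrictlyLE 0 1
    constructor
    · rintro ⟨g, h⟩
      refine ⟨0, 0, ?_⟩
      rw [h0.eq_of_src g 0] at h
      rw [← cancel_epi (P.cochainComplexXIso (-(0:ℕ)) 0 rfl).hom]
      simpa using h
    · rintro ⟨p, g, h⟩
      rw [P.complex.shape _ _ (by simp)] at h
      refine ⟨0, ?_⟩
      simp [← h]
end newext

section rel
variable {R : Type} [CommRing R] {A B N : ModuleCat.{0} R}

def oldExtMap {A B : ModuleCat.{0} R} (f : A ⟶ B) (N : ModuleCat.{0} R) (n : ℕ) :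
  ((Ext R (ModuleCat R) n).obj (Opposite.op B)).obj N → ((Ext R (ModuleCat R) n).obj (Opposite.op A)).obj N :=
  fun e => (((Ext R (ModuleCat.{0} R) n).map f.op).app N).hom e

def ExtRel (P : ProjectiveResolution A) (n : ℕ)
   (e : ((Ext R (ModuleCat R) n).obj (Opposite.op A)).obj N) (e' : Abelian.Ext A N n) : Prop :=
  ∃ (f : P.complex.X n ⟶ N) (hf : P.complex.d (n+1) n ≫ f = 0),
    HRep (P.complex.linearYonedaObj R N) n f ((P.isoExt n N).hom.hom e) ∧ P.extMk f (n+1) rfl hf = e'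

lemma ExtRel.exists_right (P : ProjectiveResolution A) (n : ℕ)
   (e : ((Ext R (ModuleCat R) n).obj (Opposite.op A)).obj N) : ∃ e', ExtRel P n e e' := by
  obtain ⟨x, hx, h⟩ := HRep.exists_rep _ n ((P.isoExt n N).hom.hom e)
  exact ⟨_, x, hx, h, rfl⟩

lemma ExtRel.exists_left (P : ProjectiveResolution A) (n : ℕ)
   (e' : Abelian.Ext A N n) : ∃ e, ExtRel P n e e' := by
  obtain ⟨f, hf, rfl⟩ := P.extMk_surjective e' (n+1) rfl
  obtain ⟨e, he⟩ := HRep.of_cocycle (P.complex.linearYonedaObj R N) n f hf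
  refine ⟨(P.isoExt n N).inv.hom e, f, hf, ?_, rfl⟩
  convert he
  exact congrArg (fun f => f.hom e) (P.isoExt n N).inv_hom_id

lemma ExtRel.eq_zero_iff {P : ProjectiveResolution A} {n : ℕ}
   {e : ((Ext R (ModuleCat R) n).obj (Opposite.op A)).obj N} {e' : Abelian.Ext A N n}
   (h : ExtRel P n e e') : e = 0 ↔ e' = 0 := by
  obtain ⟨f, hf, h, rfl⟩ := h
  rw [extMk_eq_zero_iff']
  have h1 : e = 0 ↔ (P.isoExt n N).hom.hom e = 0 := by
    constructor
    · rintro rfl; exact map_zero _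
    · intro h
      have h2 := congrArg (fun f => f.hom e) (P.isoExt n N).hom_inv_id
      have h3 : (P.isoExt n N).inv.hom ((P.isoExt n N).hom.hom e) = e := h2
      rw [← h3, h]; exact map_zero _
  rw [h1, h.eq_zero_iff]
  rfl

lemma ExtRel.map {P : ProjectiveResolution A} {Q : ProjectiveResolution B} {n : ℕ}
   {e : ((Ext R (ModuleCat R) n).obj (Opposite.op B)).obj N} {e' : Abelian.Ext B N n}
   (h : ExtRel Q n e e') (g : A ⟶ B) :
   ExtRel P n (oldExtMap g N n e) ((Abelian.Ext.mk₀ g).comp e' (zero_add _)) := by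
  obtain ⟨f, hf, h, rfl⟩ := h
  let φ : ProjectiveResolution.Hom P Q g := ⟨ProjectiveResolution.lift g P Q, by
    exact ProjectiveResolution.lift_commutes_zero g P Q⟩
  rw [ProjectiveResolution.mk₀_comp_extMk f (n+1) rfl hf φ]
  refine ⟨_, _, ?_, rfl⟩
  have := isoExt_naturality g P Q φ N n
  have h2 : (P.isoExt n N).hom.hom (oldExtMap g N n e) =
    (HomologicalComplex.homologyMap (yonedaMap φ.hom N) n).hom ((Q.isoExt n N).hom.hom e) :=
    congrArg (fun f => f.hom e) this
  rw [h2]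
  exact h.map (yonedaMap φ.hom N)

lemma oldExt_nontrivial_iff (n : ℕ) :
   Nontrivial (((Ext R (ModuleCat R) n).obj (Opposite.op A)).obj N) ↔ Nontrivial (Abelian.Ext A N n) := by
  let P := ProjectiveResolution.of A
  rw [nontrivial_iff_exists_ne 0, nontrivial_iff_exists_ne 0]
  constructor
  · rintro ⟨e, he⟩
    obtain ⟨e', h⟩ := ExtRel.exists_right P n e
    exact ⟨e', fun h' => he (h.eq_zero_iff.2 h')⟩
  · rintro ⟨e, he⟩
    obtain ⟨e', h⟩ := ExtRel.exists_left P n e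
    exact ⟨e', fun h' => he (h.eq_zero_iff.1 h')⟩

end rel

section lc
variable {R : Type} [CommRing R]
def powMap (J : Ideal R) {s t : ℕ} (h : t ≤ s) : ModuleCat.of R (R ⧸ J ^ s) ⟶ ModuleCat.of R (R ⧸ J ^ t) :=
  ModuleCat.ofHom (Submodule.mapQ _ _ LinearMap.id (Ideal.pow_le_pow_right h))

open Limits Opposite
lemma localCohomology_nontrivial_iff (J : Ideal R) (i : ℕ) (N : ModuleCat.{0} R) :
    Nontrivial ((localCohomology J i).obj N) ↔ ∃ t, ∃ e : Abelian.Ext (ModuleCat.of R (R ⧸ J ^ t)) N i,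
      ∀ s (h : t ≤ s), (Abelian.Ext.mk₀ (powMap J h)).comp e (zero_add _) ≠ 0 := by
  let F := localCohomology.diagram (localCohomology.idealPowersDiagram J) i
  let G : (ℕᵒᵖ)ᵒᵖ ⥤ ModuleCat.{0} R := F ⋙ (evaluation _ _).obj N
  let c : Cocone G := ((evaluation _ _).obj N).mapCocone (colimit.cocone F)
  let hc : IsColimit c := isColimitOfPreserves ((evaluation _ _).obj N) (colimit.isColimit F)
  have hmap : ∀ s t (h : t ≤ s) (e : G.obj (op (op t))), (G.map (homOfLE h).op.op).hom e = oldExtMap (powMap J h) N i e := by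
    intro s t h e
    rfl
  have key : ∀ t (e : G.obj (op (op t))), (c.ι.app (op (op t))).hom e = 0 ↔ ∃ s, ∃ h : t ≤ s, oldExtMap (powMap J h) N i e = 0 := by
    intro t e
    constructor
    · intro h0
      have h1 : (ConcreteCategory.hom (c.ι.app (op (op t)))) e = (ConcreteCategory.hom (c.ι.app (op (op t)))) 0 := by
        rw [map_zero]; exact h0
      obtain ⟨k, f, g, h⟩ := (Concrete.isColimit_rep_eq_iff_exists G (i := op (op t)) (j := op (op t)) hc e (0 : G.obj (op (op t)))).1 h1
      have h2 : t ≤ k.unop.unop := leOfHom f.unop.unop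
      refine ⟨k.unop.unop, h2, ?_⟩
      rw [← hmap _ _ h2]
      have : (homOfLE h2).op.op = f := Subsingleton.elim _ _
      rw [this]
      refine h.trans ?_
      exact map_zero _
    · rintro ⟨s, h, he⟩
      rw [← hmap _ _ h] at he
      have h3 := c.w ((homOfLE h).op.op)
      have h4 := congrArg (fun f => f.hom e) h3
      refine h4.symm.trans ?_
      change (c.ι.app _).hom ((G.map (homOfLE h).op.op).hom e) = 0
      rw [he]; exact map_zero _
  change Nontrivial c.pt ↔ _
  rw [nontrivial_iff_exists_ne 0]
  constructor
  · rintro ⟨x, hx⟩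
    obtain ⟨j, y, hy⟩ := Concrete.isColimit_exists_rep G hc x
    let t := j.unop.unop
    let P := ProjectiveResolution.of (ModuleCat.of R (R ⧸ J ^ t))
    obtain ⟨e', h⟩ := ExtRel.exists_right (N := N) P i y
    refine ⟨t, e', fun s hs h0 => hx ?_⟩
    rw [← hy]
    refine (key t y).2 ⟨s, hs, ?_⟩
    exact ((h.map (P := ProjectiveResolution.of _) (powMap J hs)).eq_zero_iff).2 h0
  · rintro ⟨t, e', he⟩
    let P := ProjectiveResolution.of (ModuleCat.of R (R ⧸ J ^ t))
    obtain ⟨y, h⟩ := ExtRel.exists_left (N := N) P i e'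
    refine ⟨(c.ι.app (op (op t))).hom y, fun h0 => ?_⟩
    obtain ⟨s, hs, h1⟩ := (key t y).1 h0
    exact he s hs (((h.map (P := ProjectiveResolution.of _) (powMap J hs)).eq_zero_iff).1 h1)
end lc

section ex
variable {R : Type} [CommRing R]

/-- Ext groups of unbundled modules. -/
abbrev EX (R : Type) [CommRing R] (A N : Type) [AddCommGroup A] [Module R A] [AddCommGroup N]
    [Module R N] (i : ℕ) := Abelian.Ext (ModuleCat.of R A) (ModuleCat.of R N) i

variable {A B C N N' N'' : Type} [AddCommGroup A] [Module R A] [AddCommGroup B] [Module R B]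
  [AddCommGroup C] [Module R C] [AddCommGroup N] [Module R N] [AddCommGroup N'] [Module R N']
  [AddCommGroup N''] [Module R N'']

namespace EX
def pre (f : A →ₗ[R] B) {i : ℕ} : EX R B N i →ₗ[R] EX R A N i where
  toFun e := (Abelian.Ext.mk₀ (ModuleCat.ofHom f)).comp e (zero_add _)
  map_add' := by simp
  map_smul' := by simp

def post (f : N →ₗ[R] N') {i : ℕ} : EX R A N i →ₗ[R] EX R A N' i where
  toFun e := e.comp (Abelian.Ext.mk₀ (ModuleCat.ofHom f)) (add_zero _)
  map_add' := by simp
  map_smul' := by simp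

lemma pre_pre (f : A →ₗ[R] B) (g : B →ₗ[R] C) {i : ℕ} (e : EX R C N i) :
    pre f (pre g e) = pre (g ∘ₗ f) e := by
  simp [pre, Abelian.Ext.mk₀_comp_mk₀_assoc]

lemma pre_post (f : A →ₗ[R] B) (g : N →ₗ[R] N') {i : ℕ} (e : EX R B N i) :
    pre f (post g e) = post g (pre f e) := by
  simp [pre, post]

lemma post_post (f : N →ₗ[R] N') (g : N' →ₗ[R] N'') {i : ℕ} (e : EX R A N i) :
    post g (post f e) = post (g ∘ₗ f) e := by
  simp only [post, LinearMap.coe_mk, AddHom.coe_mk]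
  rw [Abelian.Ext.comp_assoc _ _ _ (add_zero _) (add_zero _) (by simp), Abelian.Ext.mk₀_comp_mk₀]
  rfl

lemma pre_smul (r : R) {i : ℕ} (e : EX R A N i) : pre (r • LinearMap.id) e = r • e := by
  have : ModuleCat.ofHom (r • LinearMap.id : A →ₗ[R] A) = r • 𝟙 (ModuleCat.of R A) := rfl
  simp only [pre, LinearMap.coe_mk, AddHom.coe_mk, this]
  simp [Abelian.Ext.mk₀_smul]

lemma post_smul (r : R) {i : ℕ} (e : EX R A N i) : post (r • LinearMap.id) e = r • e := by
  have : ModuleCat.ofHom (r • LinearMap.id : N →ₗ[R] N) = r • 𝟙 (ModuleCat.of R N) := rfl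
  simp only [post, LinearMap.coe_mk, AddHom.coe_mk, this]
  simp [Abelian.Ext.mk₀_smul]

lemma pre_id {i : ℕ} (e : EX R A N i) : pre (LinearMap.id) e = e := by
  simpa using pre_smul (1:R) e

lemma post_id {i : ℕ} (e : EX R A N i) : post (LinearMap.id) e = e := by
  simpa using post_smul (1:R) e

/-- killed by annihilator of the first variable -/
lemma smul_eq_zero_left (r : R) (h : ∀ a : A, r • a = 0) {i : ℕ} (e : EX R A N i) : r • e = 0 := by
  rw [← pre_smul]
  have : (r • LinearMap.id : A →ₗ[R] A) = 0 := by ext; simp [h]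
  rw [this]
  have h0 : ModuleCat.ofHom (0 : A →ₗ[R] A) = 0 := rfl
  simp [pre, h0]

lemma smul_eq_zero_right (r : R) (h : ∀ a : N, r • a = 0) {i : ℕ} (e : EX R A N i) : r • e = 0 := by
  rw [← post_smul]
  have : (r • LinearMap.id : N →ₗ[R] N) = 0 := by ext; simp [h]
  rw [this]
  have h0 : ModuleCat.ofHom (0 : N →ₗ[R] N) = 0 := rfl
  simp [post, h0]

def of0 (f : A →ₗ[R] N) : EX R A N 0 := Abelian.Ext.mk₀ (ModuleCat.ofHom f)

lemma of0_surj (e : EX R A N 0) : ∃ f, of0 f = e := by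
  obtain ⟨f, rfl⟩ := (Abelian.Ext.mk₀_bijective _ _).2 e
  exact ⟨f.hom, rfl⟩

lemma of0_eq_zero {f : A →ₗ[R] N} : of0 f = 0 ↔ f = 0 := by
  rw [of0, Abelian.Ext.mk₀_eq_zero_iff]
  constructor
  · intro h; exact congrArg ModuleCat.Hom.hom h
  · rintro rfl; rfl

lemma of0_inj {f g : A →ₗ[R] N} (h : of0 f = of0 g) : f = g := by
  have := (Abelian.Ext.mk₀_bijective _ _).1 h
  exact congrArg ModuleCat.Hom.hom this

lemma pre_of0 (f : A →ₗ[R] B) (g : B →ₗ[R] N) : pre f (of0 g) = of0 (g ∘ₗ f) := by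
  simp [pre, of0]

lemma post_of0 (f : A →ₗ[R] N) (g : N →ₗ[R] N') : post g (of0 f) = of0 (g ∘ₗ f) := by
  simp [post, of0]

/-- short exact sequence -/
structure SES (f : A →ₗ[R] B) (g : B →ₗ[R] C) : Prop where
  inj : Function.Injective f
  ex : Function.Exact f g
  surj : Function.Surjective g

def SES.sc {f : A →ₗ[R] B} {g : B →ₗ[R] C} (h : SES f g) : ShortComplex (ModuleCat.{0} R) :=
  ModuleCat.shortComplexOfCompEqZero f g (by ext x; exact (h.ex (f x)).2 ⟨x, rfl⟩)

lemma SES.se {f : A →ₗ[R] B} {g : B →ₗ[R] C} (h : SES f g) : h.sc.ShortExact :=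
  ModuleCat.shortComplex_shortExact _ h.ex h.inj h.surj

def SES.cls {f : A →ₗ[R] B} {g : B →ₗ[R] C} (h : SES f g) : EX R C A 1 := h.se.extClass

/-- connecting map, second variable -/
def δ {f : N →ₗ[R] N'} {g : N' →ₗ[R] N''} (h : SES f g) {i : ℕ} (e : EX R A N'' i) : EX R A N (i+1) :=
  Abelian.Ext.comp e h.cls rfl

lemma pre_δ {f : N →ₗ[R] N'} {g : N' →ₗ[R] N''} (h : SES f g) {i : ℕ} (e : EX R B N'' i)
  (k : A →ₗ[R] B) : pre k (δ h e) = δ h (pre k e) := by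
  simp only [pre, δ, LinearMap.coe_mk, AddHom.coe_mk]
  rw [Abelian.Ext.comp_assoc _ _ _ (zero_add _) rfl (by simp)]

lemma cov₁ {f : N →ₗ[R] N'} {g : N' →ₗ[R] N''} (h : SES f g) {i : ℕ} (e : EX R A N (i+1)) (he : post f e = 0) : ∃ e' : EX R A N'' i, δ h e' = e :=
  Abelian.Ext.covariant_sequence_exact₁ _ h.se e he rfl

lemma cov₂ {f : N →ₗ[R] N'} {g : N' →ₗ[R] N''} (h : SES f g) {i : ℕ} (e : EX R A N' i) (he : post g e = 0) : ∃ e' : EX R A N i, post f e' = e :=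
  Abelian.Ext.covariant_sequence_exact₂ _ h.se e he

lemma cov₃ {f : N →ₗ[R] N'} {g : N' →ₗ[R] N''} (h : SES f g) {i : ℕ} (e : EX R A N'' i) (he : δ h e = 0) : ∃ e' : EX R A N' i, post g e' = e :=
  Abelian.Ext.covariant_sequence_exact₃ _ h.se e rfl he

lemma cov_inj {f : N →ₗ[R] N'} {g : N' →ₗ[R] N''} (h : SES f g) (e : EX R A N 0) (he : post f e = 0) : e = 0 := by
  obtain ⟨k, rfl⟩ := of0_surj e
  rw [post_of0, of0_eq_zero] at he
  rw [of0_eq_zero]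
  ext x
  apply h.inj
  simpa using LinearMap.congr_fun he x

lemma δ_post {f : N →ₗ[R] N'} {g : N' →ₗ[R] N''} (h : SES f g) {i : ℕ} (e : EX R A N' i) : δ h (post g e) = 0 := by
  simp only [post, δ, LinearMap.coe_mk, AddHom.coe_mk]
  rw [Abelian.Ext.comp_assoc _ _ _ (add_zero _) (zero_add _) (by simp)]
  have : (Abelian.Ext.mk₀ (ModuleCat.ofHom g)).comp h.cls (zero_add _) = 0 := h.se.comp_extClass
  rw [this]
  simp

lemma post_δ {f : N →ₗ[R] N'} {g : N' →ₗ[R] N''} (h : SES f g) {i : ℕ} (e : EX R A N'' i) : post f (δ h e) = 0 := by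
  simp only [post, δ, LinearMap.coe_mk, AddHom.coe_mk]
  rw [Abelian.Ext.comp_assoc _ _ _ (by rfl) (add_zero _) (by simp)]
  have : h.cls.comp (Abelian.Ext.mk₀ (ModuleCat.ofHom f)) (add_zero _) = 0 := h.se.extClass_comp
  rw [this]
  simp

lemma con₂ {a : A →ₗ[R] B} {b : B →ₗ[R] C} (h' : SES a b)
    {i : ℕ} (e : EX R B N i) (he : pre a e = 0) : ∃ e' : EX R C N i, pre b e' = e :=
  Abelian.Ext.contravariant_sequence_exact₂ h'.se _ e he

lemma con₃ {a : A →ₗ[R] B} {b : B →ₗ[R] C} (h' : SES a b)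
    {i : ℕ} (hA : Subsingleton (EX R A N i)) (e : EX R C N (i+1)) (he : pre b e = 0) : e = 0 := by
  obtain ⟨x, rfl⟩ := Abelian.Ext.contravariant_sequence_exact₃ h'.se _ e he (add_comm 1 i)
  have : x = 0 := Subsingleton.elim (α := EX R A N i) _ _
  rw [this]; exact Abelian.Ext.comp_zero _ _ _ _ _

lemma con_inj {a : A →ₗ[R] B} {b : B →ₗ[R] C} (h' : SES a b)
    (e : EX R C N 0) (he : pre b e = 0) : e = 0 := by
  obtain ⟨k, rfl⟩ := of0_surj e
  rw [pre_of0, of0_eq_zero] at he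
  rw [of0_eq_zero]
  ext x
  obtain ⟨y, rfl⟩ := h'.surj x
  exact LinearMap.congr_fun he y

lemma vanish_mid {a : A →ₗ[R] B} {b : B →ₗ[R] C} (h' : SES a b)
    {i : ℕ} (hA : Subsingleton (EX R A N i)) (hC : Subsingleton (EX R C N i)) :
    Subsingleton (EX R B N i) := by
  refine subsingleton_of_forall_eq 0 fun e => ?_
  obtain ⟨e', rfl⟩ := con₂ h' e (Subsingleton.elim _ _)
  rw [Subsingleton.elim e' 0, map_zero]

lemma vanish_right {a : A →ₗ[R] B} {b : B →ₗ[R] C} (h' : SES a b)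
    {i : ℕ} (hA : Subsingleton (EX R A N i)) (hB : Subsingleton (EX R B N (i+1))) :
    Subsingleton (EX R C N (i+1)) :=
  subsingleton_of_forall_eq 0 fun e => con₃ h' hA e (Subsingleton.elim _ _)

lemma vanish_right_zero {a : A →ₗ[R] B} {b : B →ₗ[R] C} (h' : SES a b)
    (hB : Subsingleton (EX R B N 0)) :
    Subsingleton (EX R C N 0) :=
  subsingleton_of_forall_eq 0 fun e => con_inj h' e (Subsingleton.elim _ _)
end EX

lemma EX.zero_of_injective [Module.Injective R N] {i : ℕ} (e : EX R A N (i+1)) : e = 0 := by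
  have := (Module.injective_iff_injective_object R N).1 inferInstance
  exact Abelian.Ext.eq_zero_of_injective e

lemma exists_injective_embedding (R : Type) [CommRing R] (N : Type) [AddCommGroup N] [Module R N] :
   ∃ (E : Type) (_ : AddCommGroup E) (_ : Module R E) (_ : Module.Injective R E) (f : N →ₗ[R] E),
     Function.Injective f := by
  let J := Injective.under (ModuleCat.of R N)
  have : Injective J := inferInstance
  refine ⟨J, inferInstance, inferInstance, (Module.injective_iff_injective_object R J).2 this, (Injective.ι (ModuleCat.of R N)).hom, ?_⟩
  exact (ModuleCat.mono_iff_injective _).1 inferInstance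

lemma EX.ses_mkQ {N' : Type} [AddCommGroup N'] [Module R N'] {f : N →ₗ[R] N'} (hf : Function.Injective f) :
    EX.SES f (LinearMap.range f).mkQ :=
  ⟨hf, by rw [LinearMap.exact_iff]; simp, Submodule.mkQ_surjective _⟩

lemma extGrade_eq (J : Ideal R) (M : Type) [AddCommGroup M] [Module R M] :
    sInf {i : ℕ | Nontrivial
    (((Ext R (ModuleCat R) i).obj (Opposite.op (ModuleCat.of R (R ⧸ J)))).obj (ModuleCat.of R M))} =
    sInf {i : ℕ | Nontrivial (EX R (R ⧸ J) M i)} := by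
  simp only [oldExt_nontrivial_iff]

def qmap {I J : Ideal R} (h : I ≤ J) : (R ⧸ I) →ₗ[R] (R ⧸ J) := Submodule.mapQ _ _ LinearMap.id h

@[simp] lemma qmap_mk {I J : Ideal R} (h : I ≤ J) (r : R) :
  qmap h (Ideal.Quotient.mk I r) = Ideal.Quotient.mk J r := rfl

lemma lc_nontrivial_iff (J : Ideal R) (i : ℕ) (N : Type) [AddCommGroup N] [Module R N] :
    Nontrivial ((localCohomology J i).obj (ModuleCat.of R N)) ↔ ∃ t, ∃ e : EX R (R ⧸ J ^ t) N i,
      ∀ s (h : t ≤ s), EX.pre (qmap (Ideal.pow_le_pow_right h)) e ≠ 0 :=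
  localCohomology_nontrivial_iff J i _
end ex

section torsion
variable {R : Type} [CommRing R]

def IsTors (J : Ideal R) (N : Type) [AddCommGroup N] [Module R N] : Prop :=
  ∀ x : N, ∃ k : ℕ, ∀ r ∈ J ^ k, r • x = 0

def Gam (J : Ideal R) (N : Type) [AddCommGroup N] [Module R N] : Submodule R N where
  carrier := {x | ∃ k : ℕ, ∀ r ∈ J ^ k, r • x = 0}
  zero_mem' := ⟨0, by simp⟩
  add_mem' := by
    rintro x y ⟨k, hk⟩ ⟨l, hl⟩
    refine ⟨max k l, fun r hr => ?_⟩
    rw [smul_add, hk r (Ideal.pow_le_pow_right (le_max_left _ _) hr),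
      hl r (Ideal.pow_le_pow_right (le_max_right _ _) hr), add_zero]
  smul_mem' := by
    rintro c x ⟨k, hk⟩
    exact ⟨k, fun r hr => by rw [smul_comm, hk r hr, smul_zero]⟩

lemma Gam_tors (J : Ideal R) (N : Type) [AddCommGroup N] [Module R N] : IsTors J (Gam J N) := by
  rintro ⟨x, k, hk⟩
  exact ⟨k, fun r hr => Subtype.ext (hk r hr)⟩

lemma tors_fg (J : Ideal R) {N A : Type} [AddCommGroup N] [Module R N] [AddCommGroup A] [Module R A]
    [Module.Finite R A] (hN : IsTors J N) (g : A →ₗ[R] N) : ∃ k, ∀ r ∈ J ^ k, ∀ a, r • g a = 0 := by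
  obtain ⟨s, hs⟩ := (inferInstance : Module.Finite R A).fg_top
  choose k hk using fun a => hN (g a)
  refine ⟨s.sup k, fun r hr a => ?_⟩
  have : a ∈ Submodule.span R (s : Set A) := hs ▸ trivial
  induction this using Submodule.span_induction with
  | mem x hx => exact hk x r (Ideal.pow_le_pow_right (Finset.le_sup hx) hr)
  | zero => simp
  | add x y _ _ hx hy => simp [hx, hy]
  | smul c x _ hx => rw [map_smul, smul_comm, hx, smul_zero]

lemma Gam_injective [IsNoetherianRing R] (J : Ideal R) (E : Type) [AddCommGroup E] [Module R E]
    [Module.Injective R E] : Module.Injective R (Gam J E) := by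
  apply Module.Baer.injective
  intro a g
  obtain ⟨k, hk⟩ := tors_fg J (Gam_tors J E) g
  obtain ⟨c, hc⟩ := Ideal.exists_pow_inf_eq_pow_smul J (a : Submodule R R)
  have hkill : ∀ x : a, (x : R) ∈ J ^ (k + c) → g x = 0 := by
    intro x hx
    have h1 := hc (k + c) (by omega)
    have h2 : (x : R) ∈ J ^ (k + c) • (⊤ : Submodule R R) ⊓ a := by
      refine ⟨?_, x.2⟩
      simpa using hx
    rw [h1, Nat.add_sub_cancel] at h2
    have h3 : (x : R) ∈ (J ^ k • (⊤ : Submodule R a)).map a.subtype := by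
      rw [Submodule.map_smul'', Submodule.map_top, Submodule.range_subtype]
      exact Submodule.smul_mono le_rfl inf_le_right h2
    obtain ⟨y, hy, hyx⟩ := h3
    have : y = x := Subtype.ext hyx
    subst this
    have hle : J ^ k • (⊤ : Submodule R a) ≤ LinearMap.ker g :=
      Submodule.smul_le.2 (fun r hr n _ => by rw [LinearMap.mem_ker, map_smul]; exact hk r hr n)
    exact hle hy
  let n := k + c
  let D : Submodule R a := Submodule.comap (Submodule.subtype a) (J ^ n : Ideal R)
  let f : (a ⧸ D) →ₗ[R] (R ⧸ J ^ n) := Submodule.mapQ D (J ^ n : Ideal R) (Submodule.subtype a) le_rfl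
  have hf : Function.Injective f := by
    rw [← LinearMap.ker_eq_bot, Submodule.ker_mapQ]
    exact D.mkQ_map_self
  let g' : (a ⧸ D) →ₗ[R] E := D.liftQ ((Gam J E).subtype ∘ₗ g) (fun x hx => by
    simp [hkill x hx])
  obtain ⟨h, hh⟩ := Module.Injective.out f hf g'
  have h2 : ∀ r : R, h (Ideal.Quotient.mk _ r) ∈ Gam J E := fun r => by
    refine ⟨n, fun s hs => ?_⟩
    rw [← map_smul]
    have : s • (Ideal.Quotient.mk (J ^ n) r) = 0 := by
      rw [← Ideal.Quotient.mk_eq_mk, ← Submodule.Quotient.mk_smul, Ideal.Quotient.mk_eq_mk, Ideal.Quotient.eq_zero_iff_mem]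
      exact Ideal.mul_mem_right _ _ hs
    rw [this, map_zero]
  refine ⟨(h ∘ₗ (J^n : Submodule R R).mkQ).codRestrict _ h2, fun x hx => ?_⟩
  apply Subtype.ext
  exact hh (Submodule.Quotient.mk ⟨x, hx⟩)

/-- every class dies in the direct limit of Ext -/
def VanH (J : Ideal R) (N : Type) [AddCommGroup N] [Module R N] (i : ℕ) : Prop :=
  ∀ t (e : EX R (R ⧸ J ^ t) N i), ∃ s, ∃ h : t ≤ s, EX.pre (qmap (Ideal.pow_le_pow_right h)) e = 0

lemma IsTors.quot {J : Ideal R} {N : Type} [AddCommGroup N] [Module R N] (h : IsTors J N) (D : Submodule R N) :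
    IsTors J (N ⧸ D) := by
  intro x
  obtain ⟨y, rfl⟩ := D.mkQ_surjective x
  obtain ⟨k, hk⟩ := h y
  exact ⟨k, fun r hr => by rw [← map_smul, hk r hr, map_zero]⟩

lemma vanH_of_tors [IsNoetherianRing R] (J : Ideal R) (i : ℕ) : ∀ (N : Type) [AddCommGroup N] [Module R N]
    (_ : IsTors J N), VanH J N (i+1) := by
  induction i with
  | zero =>
    intro N _ _ hN t e
    obtain ⟨E, _, _, _, f, hf⟩ := exists_injective_embedding R N
    have := Gam_injective J E
    let f' : N →ₗ[R] Gam J E := f.codRestrict _ (fun x => by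
      obtain ⟨k, hk⟩ := hN x
      exact ⟨k, fun r hr => by rw [← map_smul, hk r hr, map_zero]⟩)
    have hf' : Function.Injective f' := fun x y h => hf (congrArg Subtype.val h)
    obtain ⟨e', rfl⟩ := EX.cov₁ (EX.ses_mkQ hf') e (EX.zero_of_injective _)
    obtain ⟨h, rfl⟩ := EX.of0_surj e'
    obtain ⟨y, hy⟩ := Submodule.mkQ_surjective _ (h (Ideal.Quotient.mk _ 1))
    obtain ⟨k, hk⟩ := Gam_tors J E y
    refine ⟨max t k, le_max_left _ _, ?_⟩
    let u : (R ⧸ J ^ (max t k)) →ₗ[R] Gam J E := Submodule.liftQ _ (LinearMap.toSpanSingleton R _ y) (fun r hr =>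
      hk r (Ideal.pow_le_pow_right (le_max_right _ _) hr))
    rw [EX.pre_δ, EX.pre_of0]
    convert EX.δ_post (EX.ses_mkQ hf') (EX.of0 u)
    rw [EX.post_of0]
    congr 1
    ext
    have hu : u (Ideal.Quotient.mk _ 1) = y := by
      change (LinearMap.toSpanSingleton R _ y) 1 = y
      simp
    exact (hy.trans (by rfl)).symm.trans (congrArg _ hu.symm)
  | succ i ih =>
    intro N _ _ hN t e
    obtain ⟨E, _, _, _, f, hf⟩ := exists_injective_embedding R N
    have := Gam_injective J E
    let f' : N →ₗ[R] Gam J E := f.codRestrict _ (fun x => by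
      obtain ⟨k, hk⟩ := hN x
      exact ⟨k, fun r hr => by rw [← map_smul, hk r hr, map_zero]⟩)
    have hf' : Function.Injective f' := fun x y h => hf (congrArg Subtype.val h)
    obtain ⟨e', rfl⟩ := EX.cov₁ (EX.ses_mkQ hf') e (EX.zero_of_injective _)
    obtain ⟨s, h, hs⟩ := ih _ ((Gam_tors J E).quot _) t e'
    refine ⟨s, h, ?_⟩
    rw [EX.pre_δ, hs]
    simp [EX.δ]
end torsion

section quotses
variable {R : Type} [CommRing R]

def cmap {C I : Ideal R} {r : R} (h : ∀ f, f ∈ C ↔ r * f ∈ I) : (R ⧸ C) →ₗ[R] (R ⧸ I) :=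
  Submodule.mapQ C I (r • LinearMap.id) (fun f hf => by
    rw [Submodule.mem_comap]; simpa using (h f).1 hf)

lemma cmap_mk {C I : Ideal R} {r : R} (h : ∀ f, f ∈ C ↔ r * f ∈ I) (f : R) :
  cmap h (Ideal.Quotient.mk C f) = Ideal.Quotient.mk I (r * f) := rfl

lemma ses_colon {C I : Ideal R} {r : R} (h : ∀ f, f ∈ C ↔ r * f ∈ I) :
    EX.SES (cmap h) (qmap (le_sup_left : I ≤ I ⊔ Ideal.span {r})) := by
  refine ⟨?_, ?_, ?_⟩
  · rw [injective_iff_map_eq_zero]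
    intro x hx
    obtain ⟨f, rfl⟩ := Ideal.Quotient.mk_surjective x
    rw [cmap_mk, Ideal.Quotient.eq_zero_iff_mem] at hx
    exact Ideal.Quotient.eq_zero_iff_mem.2 ((h f).2 hx)
  · intro x
    obtain ⟨f, rfl⟩ := Ideal.Quotient.mk_surjective x
    rw [qmap_mk, Ideal.Quotient.eq_zero_iff_mem, Submodule.mem_sup]
    constructor
    · rintro ⟨y, hy, z, hz, rfl⟩
      obtain ⟨w, rfl⟩ := Ideal.mem_span_singleton'.1 hz
      refine ⟨Ideal.Quotient.mk C w, ?_⟩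
      rw [cmap_mk, mul_comm, map_add, Ideal.Quotient.eq_zero_iff_mem.2 hy, zero_add]
    · rintro ⟨y, hy⟩
      obtain ⟨w, rfl⟩ := Ideal.Quotient.mk_surjective y
      rw [cmap_mk, eq_comm, Ideal.Quotient.eq] at hy
      exact ⟨_, hy, r * w, Ideal.mem_span_singleton'.2 ⟨w, mul_comm _ _⟩, by ring⟩
  · intro x
    obtain ⟨f, rfl⟩ := Ideal.Quotient.mk_surjective x
    exact ⟨Ideal.Quotient.mk _ f, rfl⟩

lemma cmap_self {I : Ideal R} {r : R} (h : ∀ f, f ∈ I ↔ r * f ∈ I) : cmap h = r • LinearMap.id := by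
  apply LinearMap.ext
  intro x
  obtain ⟨f, rfl⟩ := Ideal.Quotient.mk_surjective x
  rfl

lemma ses_reg {I I' : Ideal R} {r : R} (h : ∀ f, r * f ∈ I → f ∈ I) (hI : I' = I ⊔ Ideal.span {r}) (hle : I ≤ I') :
    EX.SES (r • LinearMap.id : (R ⧸ I) →ₗ[R] (R ⧸ I)) (qmap hle) := by
  subst hI
  have h' : ∀ f, f ∈ I ↔ r * f ∈ I := fun f => ⟨fun hf => I.mul_mem_left _ hf, h f⟩
  have := ses_colon h'
  rwa [cmap_self] at this
end quotses

section qA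
variable {σ : Type} [Finite σ] [DecidableEq σ] (K : Type) [Field K]

def qv (A : Finset σ) : Ideal (MvPolynomial σ K) := Ideal.span (X '' (A : Set σ))
variable {K}
lemma mem_qv {A : Finset σ} {f : MvPolynomial σ K} : f ∈ qv K A ↔ ∀ d ∈ f.support, ∃ a ∈ A, d a ≠ 0 := by
  rw [qv, mem_ideal_span_X_image]; simp

lemma qv_mono {A B : Finset σ} (h : A ⊆ B) : qv K A ≤ qv K B :=
  Ideal.span_mono (Set.image_mono (by exact_mod_cast h))

lemma X_mem_qv {A : Finset σ} {a : σ} : (X a : MvPolynomial σ K) ∈ qv K A ↔ a ∈ A := by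
  rw [mem_qv]
  constructor
  · intro h
    obtain ⟨b, hb, h⟩ := h (Finsupp.single a 1) (by simp [X, support_monomial])
    have : a = b := by
      by_contra hne
      exact h (Finsupp.single_eq_of_ne (Ne.symm hne))
    exact this ▸ hb
  · intro h d hd
    simp [X, support_monomial] at hd
    exact ⟨a, h, by simp [← hd]⟩

lemma qv_insert (A : Finset σ) (x : σ) : qv K (insert x A) = qv K A ⊔ Ideal.span {X x} := by
  rw [qv, qv, ← Ideal.span_union]
  congr 1
  ext; simp [or_comm, eq_comm]

lemma monomial_mul_mem_qv {A : Finset σ} {u : σ →₀ ℕ} (hu : ∀ a ∈ A, u a = 0) {f : MvPolynomial σ K}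
   (h : monomial u 1 * f ∈ qv K A) : f ∈ qv K A := by
  rw [mem_qv] at h ⊢
  intro d hd
  obtain ⟨a, ha, h2⟩ := h (u + d) (by
    rw [mem_support_iff, coeff_monomial_mul, one_mul]; exact mem_support_iff.1 hd)
  exact ⟨a, ha, by simpa [hu a ha] using h2⟩

lemma X_mul_mem_qv {A : Finset σ} {x : σ} (hx : x ∉ A) {f : MvPolynomial σ K}
   (h : X x * f ∈ qv K A) : f ∈ qv K A := by
  refine monomial_mul_mem_qv (u := Finsupp.single x 1) (fun a ha => ?_) h
  rw [Finsupp.single_eq_of_ne]; rintro rfl; exact hx ha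

lemma qv_ne_top (A : Finset σ) : qv K A ≠ ⊤ := by
  rw [Ne, Ideal.eq_top_iff_one, mem_qv]
  intro h
  obtain ⟨a, _, h⟩ := h 0 (by simp [MvPolynomial.mem_support_iff])
  simp at h

lemma ses_qv {A : Finset σ} {x : σ} (hx : x ∉ A) :
    EX.SES ((X x : MvPolynomial σ K) • LinearMap.id) (qmap (qv_mono (K := K) (Finset.subset_insert x A))) :=
  ses_reg (fun _ h => X_mul_mem_qv hx h) (qv_insert A x) _

lemma qv_vanH (V : Finset σ) (k : ℕ) : ∀ (A : Finset σ) (_ : (V \ A).card = k) (i : ℕ) (_ : k < i),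
    VanH (qv K V) (MvPolynomial σ K ⧸ qv K A) i := by
  induction k with
  | zero =>
    intro A hA i hi
    obtain ⟨i, rfl⟩ := Nat.exists_eq_add_of_lt hi
    rw [zero_add]
    apply vanH_of_tors
    have hVA : V ⊆ A := by simpa using hA
    intro x
    obtain ⟨f, rfl⟩ := Ideal.Quotient.mk_surjective x
    refine ⟨1, fun r hr => ?_⟩
    rw [pow_one] at hr
    exact Ideal.Quotient.eq_zero_iff_mem.2 (Ideal.mul_mem_right _ _ (qv_mono hVA hr))
  | succ k ih =>
    intro A hA i hi
    obtain ⟨x, hx⟩ : (V \ A).Nonempty := by rw [← Finset.card_pos]; omega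
    have hxV := (Finset.mem_sdiff.1 hx).1
    have hxA := (Finset.mem_sdiff.1 hx).2
    have ih' := ih (insert x A) (by
      rw [Finset.sdiff_insert, Finset.card_erase_of_mem hx, hA]; rfl)
    obtain ⟨i, rfl⟩ : ∃ j, i = j + 1 := ⟨i - 1, by omega⟩
    have step : ∀ t (e : EX (MvPolynomial σ K) (MvPolynomial σ K ⧸ qv K V ^ t) (MvPolynomial σ K ⧸ qv K A) (i+1)),
       (∃ s, ∃ h : t ≤ s, EX.pre (qmap (Ideal.pow_le_pow_right h)) ((X x : MvPolynomial σ K) • e) = 0) →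
       (∃ s, ∃ h : t ≤ s, EX.pre (qmap (Ideal.pow_le_pow_right h)) e = 0) := by
      rintro t e ⟨s, h, hs⟩
      rw [map_smul, ← EX.post_smul] at hs
      obtain ⟨e3, h3⟩ := EX.cov₁ (ses_qv hxA) _ hs
      obtain ⟨s', h', h4⟩ := ih' i (by omega) s e3
      refine ⟨s', h.trans h', ?_⟩
      have h5 := EX.pre_δ (ses_qv hxA) e3 (qmap (Ideal.pow_le_pow_right h' : qv K V ^ s' ≤ qv K V ^ s))
      rw [h3, h4, EX.pre_pre] at h5
      refine Eq.trans ?_ (h5.trans (by simp [EX.δ]))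
      congr 1
      congr 1
      apply LinearMap.ext
      intro y
      obtain ⟨f, rfl⟩ := Ideal.Quotient.mk_surjective y
      rfl
    have step2 : ∀ t n (e : EX (MvPolynomial σ K) (MvPolynomial σ K ⧸ qv K V ^ t) (MvPolynomial σ K ⧸ qv K A) (i+1)),
       (X x : MvPolynomial σ K) ^ n • e = 0 →
       (∃ s, ∃ h : t ≤ s, EX.pre (qmap (Ideal.pow_le_pow_right h)) e = 0) := by
      intro t n
      induction n with
      | zero => intro e he; rw [pow_zero, one_smul] at he; exact ⟨t, le_rfl, by rw [he, map_zero]⟩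
      | succ n ihn =>
        intro e he
        apply step
        apply ihn
        rw [smul_smul, ← pow_succ, he]
    intro t e
    refine step2 t t e (EX.smul_eq_zero_left _ ?_ e)
    intro y
    obtain ⟨f, rfl⟩ := Ideal.Quotient.mk_surjective y
    exact Ideal.Quotient.eq_zero_iff_mem.2 (Ideal.mul_mem_right _ _ (Ideal.pow_mem_pow (X_mem_qv.2 hxV) t))

lemma qv_ext_vanish (V : Finset σ) (B : Type) [AddCommGroup B] [Module (MvPolynomial σ K) B] (s : ℕ)
    (hB : ∀ v ∈ V, ∀ b : B, (X v : MvPolynomial σ K) ^ s • b = 0) (k : ℕ) :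
    ∀ (A : Finset σ) (_ : (V \ A).card = k) (i : ℕ) (_ : i < k)
    (e : EX (MvPolynomial σ K) B (MvPolynomial σ K ⧸ qv K A) i), e = 0 := by
  induction k with
  | zero => intro A hA i hi; omega
  | succ k ih =>
    intro A hA i hi
    obtain ⟨x, hx⟩ : (V \ A).Nonempty := by rw [← Finset.card_pos]; omega
    have hxV := (Finset.mem_sdiff.1 hx).1
    have hxA := (Finset.mem_sdiff.1 hx).2
    have ih' := ih (insert x A) (by
      rw [Finset.sdiff_insert, Finset.card_erase_of_mem hx, hA]; rfl)
    have step : ∀ (e : EX (MvPolynomial σ K) B (MvPolynomial σ K ⧸ qv K A) i),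
        (X x : MvPolynomial σ K) • e = 0 → e = 0 := by
      intro e he
      rw [← EX.post_smul] at he
      cases i with
      | zero => exact EX.cov_inj (ses_qv hxA) e he
      | succ i =>
        obtain ⟨e3, h3⟩ := EX.cov₁ (ses_qv hxA) _ he
        rw [← h3, ih' i (by omega) e3]
        simp [EX.δ]
    have step2 : ∀ n (e : EX (MvPolynomial σ K) B (MvPolynomial σ K ⧸ qv K A) i),
        (X x : MvPolynomial σ K) ^ n • e = 0 → e = 0 := by
      intro n
      induction n with
      | zero => intro e he; simpa using he
      | succ n ihn =>
        intro e he
        apply step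
        apply ihn
        rw [smul_smul, ← pow_succ, he]
    intro e
    exact step2 s e (EX.smul_eq_zero_left _ (hB x hxV) e)

lemma qv_nonvan (V : Finset σ) (k : ℕ) : ∀ (A : Finset σ) (_ : (V \ A).card = k),
    ∃ t, ∃ e : EX (MvPolynomial σ K) (MvPolynomial σ K ⧸ qv K V ^ t) (MvPolynomial σ K ⧸ qv K A) k,
      ∀ s (h : t ≤ s), EX.pre (qmap (Ideal.pow_le_pow_right h)) e ≠ 0 := by
  induction k with
  | zero =>
    intro A hA
    have hVA : V ⊆ A := by simpa using hA
    refine ⟨1, EX.of0 (qmap (by rw [pow_one]; exact qv_mono hVA)), fun s hs h => ?_⟩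
    rw [EX.pre_of0, EX.of0_eq_zero] at h
    have := LinearMap.congr_fun h (Ideal.Quotient.mk _ 1)
    have h2 : Ideal.Quotient.mk (qv K A) 1 = 0 := this
    rw [Ideal.Quotient.eq_zero_iff_mem, ← Ideal.eq_top_iff_one] at h2
    exact qv_ne_top A h2
  | succ k ih =>
    intro A hA
    obtain ⟨x, hx⟩ : (V \ A).Nonempty := by rw [← Finset.card_pos]; omega
    have hxA := (Finset.mem_sdiff.1 hx).2
    obtain ⟨t, e, he⟩ := ih (insert x A) (by
      rw [Finset.sdiff_insert, Finset.card_erase_of_mem hx, hA]; rfl)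
    refine ⟨t, EX.δ (ses_qv hxA) e, fun s hs h => he s hs ?_⟩
    rw [EX.pre_δ] at h
    obtain ⟨e', he'⟩ := EX.cov₃ (ses_qv hxA) _ h
    rw [← he', qv_ext_vanish V _ s ?_ _ A hA k (by omega) e', map_zero]
    intro v hv y
    obtain ⟨f, rfl⟩ := Ideal.Quotient.mk_surjective y
    exact Ideal.Quotient.eq_zero_iff_mem.2 (Ideal.mul_mem_right _ _ (Ideal.pow_mem_pow (X_mem_qv.2 hv) s))

lemma qv_cohDim (V A : Finset σ) :
   sSup {i : ℕ | Nontrivial ((localCohomology (qv K V) i).obj (ModuleCat.of (MvPolynomial σ K) (MvPolynomial σ K ⧸ qv K A)))}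
    = (V \ A).card := by
  apply IsGreatest.csSup_eq
  constructor
  · rw [Set.mem_ofPred_eq, lc_nontrivial_iff]
    exact qv_nonvan V _ A rfl
  · intro i hi
    rw [Set.mem_ofPred_eq, lc_nontrivial_iff] at hi
    by_contra hlt
    obtain ⟨t, e, he⟩ := hi
    obtain ⟨s, h, hs⟩ := qv_vanH V _ A rfl i (by omega) t e
    exact he s h hs
end qA

section koszul
variable {R : Type} [CommRing R] {M N J M' : Type} [AddCommGroup M] [Module R M] [AddCommGroup N] [Module R N]
  [AddCommGroup J] [Module R J] [AddCommGroup M'] [Module R M']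

def KI : List R → Type
  | [] => Unit
  | _ :: l => KI l ⊕ KI l

def kdeg : (l : List R) → KI l → ℤ
  | [], _ => 0
  | _ :: l, x => Sum.elim (fun y : KI l => kdeg l y) (fun y : KI l => kdeg l y + 1) x

abbrev kinl {a : R} {l : List R} (f : KI (a :: l) → M) : KI l → M := fun x => f (Sum.inl x)
abbrev kinr {a : R} {l : List R} (f : KI (a :: l) → M) : KI l → M := fun x => f (Sum.inr x)
def kmk (a : R) {l : List R} (f g : KI l → M) : KI (a :: l) → M := fun x => Sum.elim f g x

lemma kext {a : R} {l : List R} {f g : KI (a :: l) → M} (h1 : kinl f = kinl g) (h2 : kinr f = kinr g) : f = g := by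
  funext x
  cases x with
  | inl x => exact congrFun h1 x
  | inr x => exact congrFun h2 x

def kd (M : Type) [AddCommGroup M] [Module R M] : (l : List R) → (KI l → M) →ₗ[R] (KI l → M)
  | [] => 0
  | a :: l =>
    { toFun := fun f => kmk a (kd M l (kinl f)) (a • kinl f - kd M l (kinr f))
      map_add' := fun f g => kext (map_add (kd M l) (kinl f) (kinl g)) (by
        change a • (kinl f + kinl g) - kd M l (kinr f + kinr g) = (a • kinl f - kd M l (kinr f)) + (a • kinl g - kd M l (kinr g))
        rw [map_add, smul_add]; abel)
      map_smul' := fun r f => kext (map_smul (kd M l) r (kinl f)) (by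
        change a • (r • kinl f) - kd M l (r • kinr f) = r • (a • kinl f - kd M l (kinr f))
        rw [map_smul, smul_sub, smul_comm]) }

lemma kd_nil (f : KI ([] : List R) → M) : kd M [] f = 0 := rfl
lemma kd_inl (a : R) (l : List R) (f : KI (a :: l) → M) : kinl (kd M (a :: l) f) = kd M l (kinl f) := rfl
lemma kd_inr (a : R) (l : List R) (f : KI (a :: l) → M) : kinr (kd M (a :: l) f) = a • kinl f - kd M l (kinr f) := rfl

lemma kd_kd (l : List R) : ∀ (f : KI l → M), kd M l (kd M l f) = 0 := by
  induction l with
  | nil => intro f; rfl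
  | cons a l ih =>
    intro f
    refine kext ?_ ?_
    · rw [kd_inl, kd_inl, ih]; rfl
    · rw [kd_inr, kd_inr, kd_inl, map_sub, map_smul, ih]; simp; rfl

def KDeg (l : List R) (i : ℤ) (f : KI l → M) : Prop := ∀ x, kdeg l x ≠ i → f x = 0

lemma KDeg_nil {i : ℤ} {f : KI ([] : List R) → M} : KDeg [] i f ↔ (i ≠ 0 → f = 0) := by
  constructor
  · intro h hi; funext x; exact h x (by simpa [kdeg] using hi.symm)
  · intro h x hx; rw [h (by simpa [kdeg] using Ne.symm hx)]; rfl

lemma KDeg_cons {a : R} {l : List R} {i : ℤ} {f : KI (a :: l) → M} :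
    KDeg (a :: l) i f ↔ KDeg l i (kinl f) ∧ KDeg l (i-1) (kinr f) := by
  constructor
  · intro h
    exact ⟨fun x hx => h (Sum.inl x) hx, fun x hx => h (Sum.inr x) (fun h' => hx (by
      change kdeg l x + 1 = i at h'; omega))⟩
  · rintro ⟨h1, h2⟩ x hx
    cases x with
    | inl x => exact h1 x hx
    | inr x => exact h2 x (fun h' => hx (by change kdeg l x + 1 = i; omega))

lemma KDeg_zero (l : List R) (i : ℤ) : KDeg l i (0 : KI l → M) := fun _ _ => rfl
lemma KDeg.add {l : List R} {i : ℤ} {f g : KI l → M} (hf : KDeg l i f) (hg : KDeg l i g) : KDeg l i (f + g) :=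
  fun x hx => by simp [hf x hx, hg x hx]
lemma KDeg.sub {l : List R} {i : ℤ} {f g : KI l → M} (hf : KDeg l i f) (hg : KDeg l i g) : KDeg l i (f - g) :=
  fun x hx => by simp [hf x hx, hg x hx]
lemma KDeg.smul {l : List R} {i : ℤ} {f : KI l → M} (r : R) (hf : KDeg l i f) : KDeg l i (r • f) :=
  fun x hx => by simp [hf x hx]

lemma KDeg.kd {l : List R} : ∀ {i : ℤ} {f : KI l → M} (_ : KDeg l i f), KDeg l (i+1) (kd M l f) := by
  induction l with
  | nil => intro i f h; exact KDeg_zero _ _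
  | cons a l ih =>
    intro i f h
    rw [KDeg_cons] at h ⊢
    rw [kd_inl, kd_inr]
    refine ⟨ih h.1, ?_⟩
    have := ih h.2
    rw [show i - 1 + 1 = i by ring] at this
    rw [show i + 1 - 1 = i by ring]
    exact (h.1.smul a).sub this

lemma kdeg_nonneg (l : List R) : ∀ x, 0 ≤ kdeg l x := by
  induction l with
  | nil => intro x; exact le_rfl
  | cons a l ih =>
    intro x
    cases x with
    | inl x => exact ih x
    | inr x => have := ih x; change 0 ≤ kdeg l x + 1; omega

lemma KDeg.eq_zero {l : List R} {i : ℤ} {f : KI l → M} (h : KDeg l i f) (hi : i < 0) : f = 0 := by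
  funext x; exact h x (by have := kdeg_nonneg l x; omega)

def k0 : (l : List R) → M → KI l → M
  | [], m => fun _ => m
  | a :: l, m => kmk a (k0 l m) 0

lemma k0_deg (l : List R) (m : M) : KDeg l 0 (k0 l m) := by
  induction l with
  | nil => rw [KDeg_nil]; simp
  | cons a l ih => rw [KDeg_cons]; exact ⟨ih, KDeg_zero _ _⟩

lemma KDeg.eq_k0 {l : List R} : ∀ {f : KI l → M} (_ : KDeg l 0 f), ∃ m, f = k0 l m := by
  induction l with
  | nil => intro f h; exact ⟨f (), rfl⟩
  | cons a l ih =>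
    intro f h
    rw [KDeg_cons] at h
    obtain ⟨m, hm⟩ := ih h.1
    exact ⟨m, kext hm (h.2.eq_zero (by omega))⟩

lemma k0_inj (l : List R) {m m' : M} (h : k0 l m = k0 l m') : m = m' := by
  induction l with
  | nil => exact congrFun h ()
  | cons a l ih => exact ih (congrArg kinl h)

lemma k0_smul (l : List R) (r : R) (m : M) : k0 l (r • m) = r • k0 l m := by
  induction l with
  | nil => rfl
  | cons a l ih => exact kext ih (by funext x; change (0:M) = r • (0:M); simp)

lemma k0_sub (l : List R) (m m' : M) : k0 l (m - m') = k0 l m - k0 l m' := by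
  induction l with
  | nil => rfl
  | cons a l ih => exact kext ih (by funext x; change (0:M) = 0 - (0:M); simp)

lemma k0_zero (l : List R) : k0 l (0 : M) = 0 := by
  have := k0_smul l (0:R) (0:M); simpa using this

lemma kd_k0 (l : List R) (m : M) : kd M l (k0 l m) = 0 ↔ ∀ a ∈ l, a • m = 0 := by
  induction l with
  | nil => simp [kd_nil]
  | cons a l ih =>
    simp only [List.mem_cons, forall_eq_or_imp, ← ih]
    constructor
    · intro h
      refine ⟨?_, congrArg kinl h⟩
      have h2 := congrArg kinr h
      rw [kd_inr] at h2
      have h3 : a • k0 l m = 0 := by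
        have : kinr (k0 (a :: l) m) = 0 := rfl
        rw [this, map_zero, sub_zero] at h2
        exact h2
      rw [← k0_smul, ← k0_zero l] at h3
      exact k0_inj l h3
    · rintro ⟨h1, h2⟩
      refine kext h2 ?_
      rw [kd_inr]
      have : kinr (k0 (a :: l) m) = 0 := rfl
      have h3 : kinl (k0 (a :: l) m) = k0 l m := rfl
      rw [this, h3, map_zero, ← k0_smul, h1, k0_zero, sub_zero]; rfl

/-- naturality -/
lemma kd_nat (l : List R) (φ : M →+ N) (hφ : ∀ a ∈ l, ∀ m, φ (a • m) = a • φ m) : ∀ f : KI l → M,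
    kd N l (fun x => φ (f x)) = fun x => φ (kd M l f x) := by
  induction l with
  | nil => intro f; funext x; change 0 = φ 0; simp
  | cons a l ih =>
    intro f
    have ih' := ih (fun b hb => hφ b (List.mem_cons_of_mem _ hb))
    refine kext (ih' (kinl f)) ?_
    rw [kd_inr]
    funext x
    have h1 := congrFun (ih' (kinr f)) x
    change a • φ (f (Sum.inl x)) - kd N l (fun x => φ (kinr f x)) x = φ (a • f (Sum.inl x) - kd M l (kinr f) x)
    rw [h1, map_sub, hφ a List.mem_cons_self]

lemma KDeg.map {l : List R} {i : ℤ} {f : KI l → M} (φ : M →+ N) (h : KDeg l i f) : KDeg l i (fun x => φ (f x)) :=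
  fun x hx => by change φ (f x) = 0; rw [h x hx, map_zero]

/-- Vanishing of Koszul cohomology -/
def Hz (l : List R) (M : Type) [AddCommGroup M] [Module R M] (i : ℤ) : Prop :=
  ∀ f : KI l → M, KDeg l i f → kd M l f = 0 → ∃ g : KI l → M, KDeg l (i-1) g ∧ kd M l g = f

lemma k0_map (l : List R) (φ : M →+ N) (m : M) : (fun x => φ (k0 l m x)) = k0 l (φ m) := by
  induction l with
  | nil => rfl
  | cons a l ih => exact kext ih (by funext x; change φ 0 = 0; simp)

lemma Hz_zero (l : List R) : Hz l M 0 ↔ ∀ m : M, (∀ a ∈ l, a • m = 0) → m = 0 := by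
  constructor
  · intro h m hm
    obtain ⟨g, hg, h2⟩ := h _ (k0_deg l m) ((kd_k0 l m).2 hm)
    rw [hg.eq_zero (by omega), map_zero] at h2
    exact k0_inj l (h2.symm.trans (k0_zero l).symm)
  · intro h f hf hd
    obtain ⟨m, rfl⟩ := hf.eq_k0
    refine ⟨0, KDeg_zero _ _, ?_⟩
    rw [h m ((kd_k0 l m).1 hd), k0_zero, map_zero]

lemma klift {l : List R} {i : ℤ} {p : J →ₗ[R] M'} (hp : Function.Surjective p) {f : KI l → M'} (hf : KDeg l i f) :
    ∃ g : KI l → J, KDeg l i g ∧ (fun x => p (g x)) = f := by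
  classical
  choose s hs using hp
  refine ⟨fun x => if kdeg l x = i then s (f x) else 0, fun x hx => by simp [hx], ?_⟩
  funext x
  by_cases hx : kdeg l x = i
  · simp [hx, hs]
  · simp [hx, hf x hx]

lemma klift' {l : List R} {i : ℤ} {ι : M →ₗ[R] J} {p : J →ₗ[R] M'} (h : EX.SES ι p) {f : KI l → J}
   (hf : KDeg l i f) (h0 : (fun x => p (f x)) = 0) :
    ∃ g : KI l → M, KDeg l i g ∧ (fun x => ι (g x)) = f := by
  choose g hg using fun x => (h.ex (f x)).1 (congrFun h0 x)
  exact ⟨g, fun x hx => h.inj (by rw [hg, hf x hx, map_zero]), funext hg⟩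

lemma kd_lin (l : List R) (φ : M →ₗ[R] N) (f : KI l → M) :
    kd N l (fun x => φ (f x)) = fun x => φ (kd M l f x) :=
  kd_nat l φ.toAddMonoidHom (fun a _ m => map_smul φ a m) f

lemma KDeg.lin {l : List R} {i : ℤ} {f : KI l → M} (φ : M →ₗ[R] N) (h : KDeg l i f) : KDeg l i (fun x => φ (f x)) :=
  h.map φ.toAddMonoidHom

lemma Hz_succ_iff {l : List R} {i : ℤ} {ι : M →ₗ[R] J} {p : J →ₗ[R] M'} (h : EX.SES ι p) (hJ : Hz l J (i+1)) :
    Hz l M (i+1) ↔ ∀ f' : KI l → M', KDeg l i f' → kd M' l f' = 0 →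
      ∃ f : KI l → J, KDeg l i f ∧ kd J l f = 0 ∧ (fun x => p (f x)) = f' := by
  have hinj : ∀ {f g : KI l → M}, (fun x => ι (f x)) = (fun x => ι (g x)) → f = g := fun hfg =>
    funext fun x => h.inj (congrFun hfg x)
  have hpi : ∀ m, p (ι m) = 0 := fun m => (h.ex _).2 ⟨m, rfl⟩
  constructor
  · intro hM f' hf' hd
    obtain ⟨f, hf, rfl⟩ := klift h.surj hf'
    rw [kd_lin] at hd
    obtain ⟨z, hz, hz2⟩ := klift' h hf.kd hd
    have hdz : kd M l z = 0 := hinj (by rw [← kd_lin, hz2, kd_kd]; funext x; simp)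
    obtain ⟨w, hw, hw2⟩ := hM z hz hdz
    rw [add_sub_cancel_right] at hw
    refine ⟨f - fun x => ι (w x), hf.sub (hw.lin ι), ?_, ?_⟩
    · rw [map_sub, kd_lin, hw2, hz2, sub_self]
    · funext x; simp [hpi]
  · intro hM z hz hdz
    obtain ⟨f, hf, hf2⟩ := hJ _ (hz.lin ι) (by rw [kd_lin, hdz]; funext x; simp)
    rw [add_sub_cancel_right] at hf
    obtain ⟨g, hg, hg2, hg3⟩ := hM _ (hf.lin p) (by rw [kd_lin, hf2]; funext x; simp [hpi])
    obtain ⟨w, hw, hw2⟩ := klift' h (hf.sub hg) (by funext x; simpa [sub_eq_zero] using (congrFun hg3 x).symm)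
    refine ⟨w, by rwa [add_sub_cancel_right], hinj ?_⟩
    rw [← kd_lin, hw2, map_sub, hg2, hf2, sub_zero]

lemma Hz_shift {l : List R} {i : ℤ} {ι : M →ₗ[R] J} {p : J →ₗ[R] M'} (h : EX.SES ι p) (hJ : Hz l J (i+1)) (hJ' : Hz l J i) :
    Hz l M (i+1) ↔ Hz l M' i := by
  rw [Hz_succ_iff h hJ]
  constructor
  · intro H f' hf' hd
    obtain ⟨f, hf, hd2, rfl⟩ := H f' hf' hd
    obtain ⟨g, hg, rfl⟩ := hJ' f hf hd2
    exact ⟨_, hg.lin p, kd_lin _ _ _⟩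
  · intro H f' hf' hd
    obtain ⟨g', hg', rfl⟩ := H f' hf' hd
    obtain ⟨g, hg, rfl⟩ := klift h.surj hg'
    refine ⟨kd J l g, by simpa using hg.kd, kd_kd _ _, (kd_lin _ _ _).symm⟩
end koszul

section kosext
variable {σ : Type} [Finite σ] [DecidableEq σ] {K : Type} [Field K]

abbrev vl (K : Type) [Field K] (vs : List σ) : List (MvPolynomial σ K) := vs.map X

variable {M : Type} [AddCommGroup M] [Module (MvPolynomial σ K) M]

lemma qv_kill {vs : List σ} {m : M} (h : ∀ a ∈ vl K vs, a • m = 0) : ∀ r ∈ qv K vs.toFinset, r • m = 0 := by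
  intro r hr
  have : qv K vs.toFinset ≤ LinearMap.ker (LinearMap.toSpanSingleton (MvPolynomial σ K) M m) := by
    rw [qv, Ideal.span_le]
    rintro _ ⟨v, hv, rfl⟩
    exact h _ (List.mem_map.2 ⟨v, by simpa using hv, rfl⟩)
  exact this hr

def qlift {I : Ideal (MvPolynomial σ K)} (m : M) (h : ∀ r ∈ I, r • m = 0) : (MvPolynomial σ K ⧸ I) →ₗ[MvPolynomial σ K] M :=
  Submodule.liftQ I (LinearMap.toSpanSingleton _ M m) (fun r hr => h r hr)

lemma qlift_one {I : Ideal (MvPolynomial σ K)} (m : M) (h : ∀ r ∈ I, r • m = 0) :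
    qlift m h (Ideal.Quotient.mk I 1) = m := by
  change (LinearMap.toSpanSingleton (MvPolynomial σ K) M m) 1 = m
  simp

lemma hom_kill {vs : List σ} (f : (MvPolynomial σ K ⧸ qv K vs.toFinset) →ₗ[MvPolynomial σ K] M) :
    ∀ a ∈ vl K vs, a • f (Ideal.Quotient.mk _ 1) = 0 := by
  intro a ha
  obtain ⟨v, hv, rfl⟩ := List.mem_map.1 ha
  rw [← map_smul]
  have : (X v : MvPolynomial σ K) • (Ideal.Quotient.mk (qv K vs.toFinset) 1) = 0 :=
    Ideal.Quotient.eq_zero_iff_mem.2 (Ideal.mul_mem_right _ _ (X_mem_qv.2 (by simpa using hv)))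
  rw [this, map_zero]

lemma hom_ext_one {I : Ideal (MvPolynomial σ K)} {f g : (MvPolynomial σ K ⧸ I) →ₗ[MvPolynomial σ K] M}
    (h : f (Ideal.Quotient.mk _ 1) = g (Ideal.Quotient.mk _ 1)) : f = g := by
  apply LinearMap.ext
  intro x
  obtain ⟨r, rfl⟩ := Ideal.Quotient.mk_surjective x
  have : Ideal.Quotient.mk I r = r • Ideal.Quotient.mk I 1 := by
    rw [← Ideal.Quotient.mk_eq_mk, ← Ideal.Quotient.mk_eq_mk, ← Submodule.Quotient.mk_smul]; simp
  rw [this, map_smul, map_smul, h]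

lemma Hz_inj (J : Type) [AddCommGroup J] [Module (MvPolynomial σ K) J] [Module.Injective (MvPolynomial σ K) J]
    (vs : List σ) : ∀ (_ : vs.Nodup) (i : ℕ), Hz (vl K vs) J (i+1) := by
  induction vs with
  | nil =>
    intro _ i f hf _
    refine ⟨0, KDeg_zero _ _, ?_⟩
    rw [KDeg_nil.1 hf (by omega), map_zero]
  | cons v vs ih =>
    intro hnd i f hf hd
    have hv : v ∉ vs := (List.nodup_cons.1 hnd).1
    have ih' := ih (List.nodup_cons.1 hnd).2
    obtain ⟨hf1, hf2⟩ := KDeg_cons.1 hf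
    rw [add_sub_cancel_right] at hf2
    have hd1 : kd J (vl K vs) (kinl f) = 0 := congrArg kinl hd
    have hd2 : (X v : MvPolynomial σ K) • kinl f - kd J (vl K vs) (kinr f) = 0 := congrArg kinr hd
    obtain ⟨h, hh, hh2⟩ := ih' i _ hf1 hd1
    rw [add_sub_cancel_right] at hh
    have hc : kd J (vl K vs) ((X v : MvPolynomial σ K) • h - kinr f) = 0 := by
      rw [map_sub, map_smul, hh2, hd2]
    have hcd := (hh.smul (X v : MvPolynomial σ K)).sub hf2
    rw [add_sub_cancel_right]
    cases i with
    | succ i =>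
      obtain ⟨k, hk, hk2⟩ := ih' i _ (by simpa using hcd) hc
      refine ⟨kmk (X v) h k, KDeg_cons.2 ⟨hh, by change KDeg (vl K vs) _ k; simpa using hk⟩, kext hh2 ?_⟩
      change (X v : MvPolynomial σ K) • h - kd J (vl K vs) k = kinr f
      rw [hk2]; abel
    | zero =>
      obtain ⟨c, hc'⟩ := KDeg.eq_k0 (by simpa using hcd)
      rw [hc', kd_k0] at hc
      have hvA : v ∉ vs.toFinset := by simpa using hv
      obtain ⟨φ, hφ⟩ := Module.Injective.out _ (ses_qv (K := K) hvA).inj (qlift c (qv_kill hc))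
      let c' := φ (Ideal.Quotient.mk _ 1)
      have hc1 : (X v : MvPolynomial σ K) • c' = c := by
        rw [← qlift_one c (qv_kill hc), ← hφ, ← map_smul]; rfl
      have hc2 := hom_kill φ
      refine ⟨kmk (X v) (h - k0 _ c') 0, KDeg_cons.2 ⟨?_, KDeg_zero _ _⟩, kext ?_ ?_⟩
      · exact hh.sub (by simpa using k0_deg _ c')
      · change kd J (vl K vs) (h - k0 _ c') = kinl f
        rw [map_sub, hh2, (kd_k0 _ _).2 hc2, sub_zero]
      · change (X v : MvPolynomial σ K) • (h - k0 _ c') - kd J (vl K vs) 0 = kinr f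
        rw [map_zero, sub_zero, smul_sub, ← k0_smul, hc1, ← hc']; abel

lemma ext_iff_Hz (vs : List σ) (hnd : vs.Nodup) (i : ℕ) : ∀ (M : Type) [AddCommGroup M] [Module (MvPolynomial σ K) M],
    Subsingleton (EX (MvPolynomial σ K) (MvPolynomial σ K ⧸ qv K vs.toFinset) M i) ↔ Hz (vl K vs) M i := by
  have key : ∀ i : ℕ, ∀ (M J M' : Type) [AddCommGroup M] [Module (MvPolynomial σ K) M]
      [AddCommGroup J] [Module (MvPolynomial σ K) J] [AddCommGroup M'] [Module (MvPolynomial σ K) M']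
      [Module.Injective (MvPolynomial σ K) J]
      (ι : M →ₗ[MvPolynomial σ K] J) (p : J →ₗ[MvPolynomial σ K] M') (h : EX.SES ι p),
      Subsingleton (EX (MvPolynomial σ K) (MvPolynomial σ K ⧸ qv K vs.toFinset) M (i+1)) ↔
      ∀ e' : EX (MvPolynomial σ K) (MvPolynomial σ K ⧸ qv K vs.toFinset) M' i,
        ∃ e : EX (MvPolynomial σ K) (MvPolynomial σ K ⧸ qv K vs.toFinset) J i, EX.post p e = e' := by
    intro i M J M' _ _ _ _ _ _ _ ι p h
    constructor
    · intro hs e'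
      exact EX.cov₃ h e' (Subsingleton.elim _ _)
    · intro H
      refine subsingleton_of_forall_eq 0 fun e => ?_
      obtain ⟨e', rfl⟩ := EX.cov₁ h e (EX.zero_of_injective _)
      obtain ⟨e2, rfl⟩ := H e'
      exact EX.δ_post h e2
  induction i with
  | zero =>
    intro M _ _
    rw [Nat.cast_zero, Hz_zero]
    constructor
    · intro hs m hm
      have := (EX.of0_eq_zero (f := qlift m (qv_kill hm))).1 (Subsingleton.elim _ _)
      rw [← qlift_one m (qv_kill hm), this]; rfl
    · intro H
      refine subsingleton_of_forall_eq 0 fun e => ?_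
      obtain ⟨f, rfl⟩ := EX.of0_surj e
      rw [EX.of0_eq_zero]
      exact hom_ext_one (H _ (hom_kill f))
  | succ i ih =>
    intro M _ _
    obtain ⟨J, _, _, _, f, hf⟩ := exists_injective_embedding (MvPolynomial σ K) M
    have hses := EX.ses_mkQ hf
    rw [key i M J _ f _ hses, Nat.cast_succ]
    cases i with
    | succ i =>
      rw [Hz_shift hses (Hz_inj J vs hnd _) (by simpa using Hz_inj J vs hnd i), ← ih]
      constructor
      · intro H
        refine subsingleton_of_forall_eq 0 fun e => ?_
        obtain ⟨e, rfl⟩ := H e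
        rw [EX.zero_of_injective e, map_zero]
      · intro H e'
        exact ⟨0, Subsingleton.elim _ _⟩
    | zero =>
      rw [Hz_succ_iff hses (Hz_inj J vs hnd _)]
      simp only [Nat.cast_zero]
      constructor
      · intro H f' hf' hd
        obtain ⟨m', rfl⟩ := hf'.eq_k0
        rw [kd_k0] at hd
        obtain ⟨e, he⟩ := H (EX.of0 (qlift m' (qv_kill hd)))
        obtain ⟨φ, rfl⟩ := EX.of0_surj e
        rw [EX.post_of0] at he
        have h1 := LinearMap.congr_fun (EX.of0_inj he) (Ideal.Quotient.mk _ 1)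
        rw [qlift_one, LinearMap.comp_apply] at h1
        refine ⟨k0 _ (φ (Ideal.Quotient.mk _ 1)), k0_deg _ _, (kd_k0 _ _).2 (hom_kill φ), ?_⟩
        rw [← h1]
        exact k0_map _ ((LinearMap.range f).mkQ.toAddMonoidHom) _
      · intro H e'
        obtain ⟨φ, rfl⟩ := EX.of0_surj e'
        obtain ⟨g, hg, hd, hg2⟩ := H (k0 _ (φ (Ideal.Quotient.mk _ 1))) (k0_deg _ _) ((kd_k0 _ _).2 (hom_kill φ))
        obtain ⟨m, rfl⟩ := hg.eq_k0
        rw [kd_k0] at hd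
        refine ⟨EX.of0 (qlift m (qv_kill hd)), ?_⟩
        rw [EX.post_of0]
        congr 1
        apply hom_ext_one
        rw [LinearMap.comp_apply, qlift_one]
        have h3 := k0_map (vl K vs) ((LinearMap.range f).mkQ.toAddMonoidHom) m
        exact k0_inj _ (h3.symm.trans hg2)
end kosext

section nak
variable {R : Type} [CommRing R] {M : Type} [AddCommGroup M] [Module R M]

lemma nak_step {a : R} {l : List R} {i : ℤ} (H : Hz (a :: l) M (i+1)) {z : KI l → M} (hz : KDeg l i z)
    (hd : kd M l z = 0) : ∃ w v, KDeg l i w ∧ KDeg l (i-1) v ∧ kd M l w = 0 ∧ z = a • w + kd M l v := by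
  obtain ⟨g, hg, hg2⟩ := H (kmk a 0 z) (KDeg_cons.2 ⟨KDeg_zero _ _, by
    change KDeg l _ z; rwa [add_sub_cancel_right]⟩) (kext (by
      change kd M l 0 = 0; simp) (by
      change a • (0 : KI l → M) - kd M l z = 0; rw [hd]; simp))
  rw [add_sub_cancel_right] at hg
  obtain ⟨h1, h2⟩ := KDeg_cons.1 hg
  refine ⟨kinl g, - kinr g, h1, ?_, congrArg kinl hg2, ?_⟩
  · simpa using (KDeg_zero (M := M) l (i-1)).sub h2
  · have := congrArg kinr hg2
    rw [kd_inr] at this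
    change _ = z at this
    rw [map_neg, ← this, sub_eq_add_neg]

lemma nak_iter {a : R} {l : List R} {i : ℤ} (H : Hz (a :: l) M (i+1)) {z : KI l → M} (hz : KDeg l i z)
    (hd : kd M l z = 0) (k : ℕ) : ∃ w v, KDeg l i w ∧ KDeg l (i-1) v ∧ kd M l w = 0 ∧ z = a ^ k • w + kd M l v := by
  induction k with
  | zero => exact ⟨z, 0, hz, KDeg_zero _ _, hd, by simp⟩
  | succ k ih =>
    obtain ⟨w, v, h1, h2, h3, h4⟩ := ih
    obtain ⟨w', v', h1', h2', h3', h4'⟩ := nak_step H h1 h3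
    refine ⟨w', a ^ k • v' + v, h1', (h2'.smul _).add h2, h3', ?_⟩
    rw [h4, h4', map_add, map_smul, smul_add, pow_succ, mul_smul]; abel

lemma KI_finite (l : List R) : Finite (KI l) := by
  induction l with
  | nil => exact inferInstanceAs (Finite Unit)
  | cons a l ih => exact inferInstanceAs (Finite (KI l ⊕ KI l))

lemma nak_abs {a : R} {l : List R} {i : ℤ} (H : Hz (a :: l) M (i+1)) (φ : ℕ → M →+ M)
    (h1 : ∀ j, ∀ b ∈ l, ∀ m, φ j (b • m) = b • φ j m) (h2 : ∀ j m, φ j (a ^ (j+1) • m) = 0)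
    (h3 : ∀ m, ∃ D, ∀ D', D ≤ D' → m = ∑ j ∈ Finset.range D', φ j m) : Hz l M i := by
  intro z hz hd
  have hj : ∀ j, ∃ u, KDeg l (i-1) u ∧ kd M l u = fun x => φ j (z x) := by
    intro j
    obtain ⟨w, v, -, hv, -, h⟩ := nak_iter H hz hd (j+1)
    refine ⟨fun x => φ j (v x), hv.map _, ?_⟩
    rw [kd_nat l (φ j) (h1 j)]
    funext x
    rw [h]
    simp [h2]
  choose u hu hu2 using hj
  choose D hD using h3
  have := KI_finite l
  have := Fintype.ofFinite (KI l)
  let D0 := ∑ x, D (z x)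
  refine ⟨∑ j ∈ Finset.range D0, u j, ?_, ?_⟩
  · intro x hx
    rw [Finset.sum_apply]
    exact Finset.sum_eq_zero fun j _ => hu j x hx
  · rw [map_sum]
    funext x
    rw [Finset.sum_apply]
    simp only [hu2]
    exact (hD (z x) D0 (Finset.single_le_sum (f := fun x => D (z x)) (fun _ _ => Nat.zero_le _) (Finset.mem_univ x))).symm
end nak

section mon
variable {σ : Type} [Finite σ] [DecidableEq σ] {K : Type} [Field K]

def Mon (I : Ideal (MvPolynomial σ K)) : Prop := ∀ f ∈ I, ∀ d ∈ f.support, monomial d (1:K) ∈ I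

lemma mem_of_mons {I : Ideal (MvPolynomial σ K)} {f : MvPolynomial σ K} (h : ∀ d ∈ f.support, monomial d (1:K) ∈ I) : f ∈ I := by
  rw [f.as_sum]
  refine Ideal.sum_mem _ fun d hd => ?_
  have := I.mul_mem_left (C (coeff d f)) (h d hd)
  rwa [C_mul_monomial, mul_one] at this

def proj (v : σ) (j : ℕ) : MvPolynomial σ K →+ MvPolynomial σ K :=
  (weightedHomogeneousComponent (R := K) (Pi.single v 1 : σ → ℕ) j).toAddMonoidHom

lemma coeff_proj (v : σ) (j : ℕ) (f : MvPolynomial σ K) (d : σ →₀ ℕ) :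
    coeff d (proj v j f) = if d v = j then coeff d f else 0 := by
  classical
  have : Finsupp.weight (Pi.single v 1 : σ → ℕ) d = d v := by
    rw [Finsupp.weight_apply, Finsupp.sum]
    simp [Pi.single_apply]
    intro h; exact h.symm
  change coeff d (weightedHomogeneousComponent (R := K) (Pi.single v 1 : σ → ℕ) j f) = _
  rw [coeff_weightedHomogeneousComponent, this]

lemma proj_mem {I : Ideal (MvPolynomial σ K)} (hI : Mon I) (v : σ) (j : ℕ) : ∀ f ∈ I, proj v j f ∈ I := by
  intro f hf
  refine mem_of_mons fun d hd => hI f hf d ?_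
  rw [mem_support_iff, coeff_proj] at hd
  rw [mem_support_iff]
  intro h
  simp [h] at hd

def qproj {I : Ideal (MvPolynomial σ K)} (hI : Mon I) (v : σ) (j : ℕ) : (MvPolynomial σ K ⧸ I) →+ (MvPolynomial σ K ⧸ I) :=
  QuotientAddGroup.map I.toAddSubgroup I.toAddSubgroup (proj v j) (fun f hf => proj_mem hI v j f hf)

lemma qproj_mk {I : Ideal (MvPolynomial σ K)} (hI : Mon I) (v : σ) (j : ℕ) (f : MvPolynomial σ K) :
    qproj hI v j (Ideal.Quotient.mk I f) = Ideal.Quotient.mk I (proj v j f) := rfl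

lemma smul_mk {I : Ideal (MvPolynomial σ K)} (r f : MvPolynomial σ K) :
    r • (Ideal.Quotient.mk I f) = Ideal.Quotient.mk I (r * f) := rfl

lemma nak_Hz {I : Ideal (MvPolynomial σ K)} (hI : Mon I) {v : σ} {vs : List σ} (hv : v ∉ vs) {i : ℤ}
    (H : Hz (vl K (v :: vs)) (MvPolynomial σ K ⧸ I) (i+1)) : Hz (vl K vs) (MvPolynomial σ K ⧸ I) i := by
  refine nak_abs (a := (X v : MvPolynomial σ K)) H (qproj hI v) ?_ ?_ ?_
  · intro j b hb m
    obtain ⟨f, rfl⟩ := Ideal.Quotient.mk_surjective m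
    obtain ⟨x, hx, rfl⟩ := List.mem_map.1 hb
    have hxv : x ≠ v := fun h => hv (h ▸ hx)
    rw [smul_mk, qproj_mk, qproj_mk, smul_mk]
    congr 1
    ext d
    rw [coeff_proj, coeff_X_mul', coeff_X_mul', coeff_proj]
    by_cases h : x ∈ d.support <;> simp [h, hxv, Ne.symm hxv]
  · intro j m
    obtain ⟨f, rfl⟩ := Ideal.Quotient.mk_surjective m
    rw [smul_mk, qproj_mk]
    convert map_zero (Ideal.Quotient.mk I)
    ext d
    rw [coeff_proj, X_pow_eq_monomial, coeff_monomial_mul']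
    split_ifs with h1 h2
    · have := h2 v
      simp at this
      omega
    · simp
    · simp
  · intro m
    obtain ⟨f, rfl⟩ := Ideal.Quotient.mk_surjective m
    refine ⟨f.totalDegree + 1, fun D' hD' => ?_⟩
    simp only [qproj_mk]
    rw [← map_sum]
    congr 1
    ext d
    rw [coeff_sum]
    simp only [coeff_proj]
    by_cases hd : coeff d f = 0
    · simp [hd]
    · rw [Finset.sum_ite_eq, if_pos]
      rw [Finset.mem_range]
      have h1 := le_totalDegree (mem_support_iff.2 hd)
      have h2 : d v ≤ d.sum fun _ e => e := by
        by_cases hv : v ∈ d.support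
        · exact Finset.single_le_sum (f := fun x => d x) (fun _ _ => Nat.zero_le _) hv
        · rw [Finsupp.notMem_support_iff] at hv; omega
      omega

lemma nak_ext {I : Ideal (MvPolynomial σ K)} (hI : Mon I) {v : σ} {A : Finset σ} (hv : v ∉ A) {i : ℕ}
    (H : Subsingleton (EX (MvPolynomial σ K) (MvPolynomial σ K ⧸ qv K (insert v A)) (MvPolynomial σ K ⧸ I) (i+1))) :
    Subsingleton (EX (MvPolynomial σ K) (MvPolynomial σ K ⧸ qv K A) (MvPolynomial σ K ⧸ I) i) := by
  have e1 : (v :: A.toList).toFinset = insert v A := by simp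
  have e2 : (A.toList).toFinset = A := by simp
  rw [← e1, ext_iff_Hz _ (List.nodup_cons.2 ⟨by simpa using hv, A.nodup_toList⟩)] at H
  rw [← e2, ext_iff_Hz _ A.nodup_toList]
  exact nak_Hz hI (by simpa using hv) (by simpa using H)

/-- iterated: remove the set B -/
lemma nak_ext_union {I : Ideal (MvPolynomial σ K)} (hI : Mon I) {A B : Finset σ} (hd : Disjoint A B) {i : ℕ}
    (H : Subsingleton (EX (MvPolynomial σ K) (MvPolynomial σ K ⧸ qv K (A ∪ B)) (MvPolynomial σ K ⧸ I) (i+B.card))) :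
    Subsingleton (EX (MvPolynomial σ K) (MvPolynomial σ K ⧸ qv K A) (MvPolynomial σ K ⧸ I) i) := by
  induction B using Finset.induction_on generalizing i with
  | empty => rw [Finset.card_empty, Finset.union_empty] at H; exact H
  | insert b B hb ih =>
    rw [Finset.disjoint_insert_right] at hd
    refine ih hd.2 (nak_ext hI (v := b) (by simp [hd.1, hb]) ?_)
    rw [Finset.card_insert_of_notMem hb, Finset.union_insert] at H
    exact H
end mon

section monind
variable {σ : Type} [Finite σ] [DecidableEq σ] {K : Type} [Field K]

lemma mon_span (T : Set (σ →₀ ℕ)) : Mon (Ideal.span ((fun d => (monomial d (1 : K))) '' T)) := by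
  intro f hf d hd
  rw [mem_ideal_span_monomial_image] at hf
  obtain ⟨t, ht, htd⟩ := hf d hd
  have : monomial d (1:K) = monomial (d - t) 1 * monomial t 1 := by
    rw [monomial_mul, tsub_add_cancel_of_le htd, one_mul]
  rw [this]
  exact Ideal.mul_mem_left _ _ (Ideal.subset_span ⟨t, ht, rfl⟩)

lemma mon_sup {I J : Ideal (MvPolynomial σ K)} (hI : Mon I) (hJ : Mon J) : Mon (I ⊔ J) := by
  intro f hf d hd
  obtain ⟨g, hg, h, hh, rfl⟩ := Submodule.mem_sup.1 hf
  have := support_add hd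
  rw [Finset.mem_union] at this
  rcases this with h1 | h1
  · exact Ideal.mem_sup_left (hI g hg d h1)
  · exact Ideal.mem_sup_right (hJ h hh d h1)

lemma mon_mono (u : σ →₀ ℕ) : Mon (Ideal.span {(monomial u (1:K))}) := by
  simpa using mon_span (K := K) {u}

lemma mon_X (x : σ) : Mon (Ideal.span {(X x : MvPolynomial σ K)}) := mon_mono _

def colonX (x : σ) (J : Ideal (MvPolynomial σ K)) : Ideal (MvPolynomial σ K) :=
  Submodule.comap (LinearMap.mulLeft (MvPolynomial σ K) (X x)) J

lemma mem_colonX {x : σ} {J : Ideal (MvPolynomial σ K)} (f : MvPolynomial σ K) : f ∈ colonX x J ↔ X x * f ∈ J := Iff.rfl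

lemma le_colonX (x : σ) (J : Ideal (MvPolynomial σ K)) : J ≤ colonX x J := fun _ hf => J.mul_mem_left _ hf

lemma mon_colonX (x : σ) {J : Ideal (MvPolynomial σ K)} (hJ : Mon J) : Mon (colonX x J) := by
  intro f hf d hd
  rw [mem_colonX] at hf ⊢
  have := hJ _ hf (Finsupp.single x 1 + d) (by
    rw [mem_support_iff, coeff_X_mul]; exact mem_support_iff.1 hd)
  rw [X, monomial_mul, one_mul]
  exact this

lemma mon_qv (A : Finset σ) : Mon (qv K A) := by
  have := mon_span (K := K) ((fun a => Finsupp.single a 1) '' (A : Set σ))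
  rw [Set.image_image] at this
  exact this

lemma mon_ind (C : Ideal (MvPolynomial σ K) → Prop) (htop : C ⊤)
    (hq : ∀ A, (∀ J, Mon J → qv K A < J → C J) → C (qv K A))
    (hx : ∀ J x, Mon J → C (colonX x J) → C (J ⊔ Ideal.span {X x}) → C J) : ∀ J, Mon J → C J := by
  intro J
  induction J using WellFoundedGT.induction with
  | ind J ih =>
  intro hJ
  by_cases hJt : J = ⊤
  · rw [hJt]; exact htop
  by_cases hex : ∃ x, X x ∉ J ∧ colonX x J ≠ J
  · obtain ⟨x, h1, h2⟩ := hex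
    refine hx J x hJ (ih _ (lt_of_le_of_ne (le_colonX x J) h2.symm) (mon_colonX x hJ)) (ih _ ?_ (mon_sup hJ (mon_X x)))
    refine lt_of_le_of_ne le_sup_left fun h => h1 ?_
    rw [h]
    exact Ideal.mem_sup_right (Ideal.mem_span_singleton_self _)
  · push Not at hex
    have := Fintype.ofFinite σ
    classical
    let A : Finset σ := Finset.univ.filter fun x => (X x : MvPolynomial σ K) ∈ J
    have hd : ∀ n : ℕ, ∀ d : σ →₀ ℕ, d.degree = n → monomial d (1:K) ∈ J → monomial d (1:K) ∈ qv K A := by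
      intro n
      induction n with
      | zero =>
        intro d hd hm
        rw [Finsupp.degree_eq_zero_iff] at hd
        subst hd
        exact absurd ((Ideal.eq_top_iff_one _).2 hm) hJt
      | succ n ihn =>
        intro d hd hm
        have : d ≠ 0 := by rintro rfl; simp at hd
        obtain ⟨x, hx⟩ := Finsupp.ne_iff.1 this
        have hle : Finsupp.single x 1 ≤ d := by
          rw [Finsupp.single_le_iff]; simp at hx; omega
        obtain ⟨d', rfl⟩ := exists_add_of_le hle
        have e : monomial (Finsupp.single x 1 + d') (1:K) = X x * monomial d' 1 := by
          rw [X, monomial_mul, one_mul]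
        rw [e] at hm ⊢
        by_cases hxJ : X x ∈ J
        · exact Ideal.mul_mem_right _ _ (X_mem_qv.2 (by simpa [A] using hxJ))
        · refine Ideal.mul_mem_left _ _ (ihn d' ?_ ?_)
          · rw [map_add] at hd; simp at hd; omega
          · rw [← hex x hxJ]; exact hm
    have hJA : J = qv K A := by
      apply le_antisymm
      · intro f hf
        exact mem_of_mons fun d hd' => hd _ d rfl (hJ f hf d hd')
      · refine Ideal.span_le.2 ?_
        rintro _ ⟨a, ha, rfl⟩
        simpa [A] using ha
    rw [hJA]
    apply hq
    intro J' hJ' hlt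
    rw [← hJA] at hlt
    exact ih J' hlt hJ'

def kill (K : Type) [Field K] (A : Finset σ) : MvPolynomial σ K →ₐ[K] MvPolynomial {x // x ∉ A} K :=
  aeval (fun x => if h : x ∈ A then 0 else X ⟨x, h⟩)

lemma kill_ker (A : Finset σ) : RingHom.ker (kill K A) = qv K A := by
  apply le_antisymm
  · intro f hf
    rw [RingHom.mem_ker] at hf
    have : (Ideal.Quotient.mkₐ K (qv K A)).comp ((rename Subtype.val).comp (kill K A)) = Ideal.Quotient.mkₐ K (qv K A) := by
      ext x
      by_cases h : x ∈ A
      · simp [kill, h]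
        exact (Ideal.Quotient.eq_zero_iff_mem.2 (X_mem_qv.2 h)).symm
      · simp [kill, h]
    have h2 := DFunLike.congr_fun this f
    simp only [AlgHom.comp_apply, hf, map_zero] at h2
    exact Ideal.Quotient.eq_zero_iff_mem.1 h2.symm
  · refine Ideal.span_le.2 ?_
    rintro _ ⟨a, ha, rfl⟩
    have : a ∈ A := ha
    simp [kill, this]

lemma qv_prime (A : Finset σ) : (qv K A).IsPrime := by
  rw [← kill_ker]; exact RingHom.ker_isPrime _

lemma kill_surj (A : Finset σ) : Function.Surjective (kill K A) := by
  intro f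
  refine ⟨rename Subtype.val f, ?_⟩
  have : (kill K A).comp (rename Subtype.val) = AlgHom.id K _ := by
    ext x
    simp [kill, x.2]
  exact DFunLike.congr_fun this f

lemma card_le_dim {I : Ideal (MvPolynomial σ K)} {A : Finset σ} (h : I ≤ qv K A) :
    ((Nat.card {x // x ∉ A} : ℕ) : WithBot ℕ∞) ≤ ringKrullDim (MvPolynomial σ K ⧸ I) := by
  have h1 : ∀ a ∈ I, (kill K A).toRingHom a = 0 := fun a ha => by
    have := h ha; rw [← kill_ker] at this; exact this
  have := ringKrullDim_le_of_surjective (Ideal.Quotient.lift I (kill K A).toRingHom h1)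
    (Ideal.Quotient.lift_surjective_of_surjective I h1 (kill_surj A))
  rw [MvPolynomial.ringKrullDim_of_isNoetherianRing, ringKrullDim_eq_zero_of_field, zero_add] at this
  exact this

lemma ass_qv (A : Finset σ) : associatedPrimes (MvPolynomial σ K) (MvPolynomial σ K ⧸ qv K A) = {qv K A} := by
  have := qv_prime (K := K) A
  rw [associatedPrimes.eq_singleton_of_isPrimary this.isPrimary, this.radical]

lemma ass_mon : ∀ J : Ideal (MvPolynomial σ K), Mon J → ∀ p ∈ associatedPrimes (MvPolynomial σ K) (MvPolynomial σ K ⧸ J), ∃ A, p = qv K A := by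
  refine mon_ind _ ?_ ?_ ?_
  · intro p hp
    have : Subsingleton (MvPolynomial σ K ⧸ (⊤ : Ideal (MvPolynomial σ K))) := Ideal.Quotient.subsingleton_iff.2 rfl
    rw [associatedPrimes.eq_empty_of_subsingleton] at hp
    exact hp.elim
  · intro A _ p hp
    rw [ass_qv] at hp
    exact ⟨A, hp⟩
  · intro J x hJ h1 h2 p hp
    have h := ses_colon (mem_colonX (x := x) (J := J))
    rcases associatedPrimes.subset_union_of_exact h.inj h.ex hp with h | h
    · exact h1 p h
    · exact h2 p h

variable [Fintype σ]

lemma card_compl_sub (A : Finset σ) : Nat.card {x // x ∉ A} = Aᶜ.card := by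
  rw [Nat.card_eq_fintype_card, Fintype.card_subtype]
  congr 1
  ext; simp
end monind

section core
variable {σ : Type} [Fintype σ] [DecidableEq σ] {K : Type} [Field K]

lemma ass_le {I p : Ideal (MvPolynomial σ K)} (hp : p ∈ associatedPrimes (MvPolynomial σ K) (MvPolynomial σ K ⧸ I)) : I ≤ p := by
  have := IsAssociatedPrime.annihilator_le hp
  rwa [Submodule.annihilator_top, Ideal.annihilator_quotient] at this

lemma ass_hom {I p : Ideal (MvPolynomial σ K)} (hp : p ∈ associatedPrimes (MvPolynomial σ K) (MvPolynomial σ K ⧸ I)) :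
    ¬ Subsingleton (EX (MvPolynomial σ K) (MvPolynomial σ K ⧸ p) (MvPolynomial σ K ⧸ I) 0) := by
  intro hs
  obtain ⟨hpp, f, hf⟩ := (isAssociatedPrime_iff_exists_injective_linearMap _ _).1 hp
  have h0 : f = 0 := EX.of0_eq_zero.1 (Subsingleton.elim (EX.of0 f) 0)
  have : (Ideal.Quotient.mk p 1) = 0 := hf (by rw [h0]; rfl)
  rw [Ideal.Quotient.eq_zero_iff_mem] at this
  exact hpp.ne_top ((Ideal.eq_top_iff_one _).2 this)

theorem core {I : Ideal (MvPolynomial σ K)} (hI : Mon I) (d : ℕ) (hd : (d : WithBot ℕ∞) = ringKrullDim (MvPolynomial σ K ⧸ I))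
    (hE : ∀ i < d, Subsingleton (EX (MvPolynomial σ K) (MvPolynomial σ K ⧸ qv K (Finset.univ : Finset σ)) (MvPolynomial σ K ⧸ I) i))
    (V : Finset σ) :
    sInf {i : ℕ | Nontrivial (EX (MvPolynomial σ K) (MvPolynomial σ K ⧸ qv K V) (MvPolynomial σ K ⧸ I) i)} =
    sInf ((fun p => sSup {i : ℕ | Nontrivial ((localCohomology (qv K V) i).obj (ModuleCat.of (MvPolynomial σ K) (MvPolynomial σ K ⧸ p)))}) ''
      associatedPrimes (MvPolynomial σ K) (MvPolynomial σ K ⧸ I)) := by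
  have hExt : ∀ (A : Finset σ) (i : ℕ), i + Aᶜ.card < d →
      Subsingleton (EX (MvPolynomial σ K) (MvPolynomial σ K ⧸ qv K A) (MvPolynomial σ K ⧸ I) i) := by
    intro A i hi
    refine nak_ext_union hI (B := Aᶜ) disjoint_compl_right ?_
    rw [Finset.union_compl]
    exact hE _ hi
  have hB : ∀ B : Finset σ, qv K B ∈ associatedPrimes (MvPolynomial σ K) (MvPolynomial σ K ⧸ I) → Bᶜ.card = d := by
    intro B hB
    apply le_antisymm
    · have := card_le_dim (ass_le hB)
      rw [← hd, card_compl_sub] at this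
      exact_mod_cast this
    · by_contra hlt
      exact ass_hom hB (hExt B 0 (by omega))
  have hnt : Nontrivial (MvPolynomial σ K ⧸ I) := by
    by_contra h
    rw [not_nontrivial_iff_subsingleton] at h
    rw [ringKrullDim_eq_bot_of_subsingleton] at hd
    exact absurd hd (by simp)
  have hne := associatedPrimes.nonempty (MvPolynomial σ K) (MvPolynomial σ K ⧸ I)
  set k0 := sInf ((fun p => sSup {i : ℕ | Nontrivial ((localCohomology (qv K V) i).obj (ModuleCat.of (MvPolynomial σ K) (MvPolynomial σ K ⧸ p)))}) ''
      associatedPrimes (MvPolynomial σ K) (MvPolynomial σ K ⧸ I)) with hk0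
  have hle : ∀ B : Finset σ, qv K B ∈ associatedPrimes (MvPolynomial σ K) (MvPolynomial σ K ⧸ I) → k0 ≤ (V \ B).card := by
    intro B hB
    rw [← qv_cohDim (K := K) V B]
    exact Nat.sInf_le ⟨_, hB, rfl⟩
  obtain ⟨B0, hB0, hB0k⟩ : ∃ B : Finset σ, qv K B ∈ associatedPrimes (MvPolynomial σ K) (MvPolynomial σ K ⧸ I) ∧ (V \ B).card = k0 := by
    obtain ⟨p, hp, hpk⟩ := Nat.sInf_mem (hne.image (fun p => sSup {i : ℕ | Nontrivial ((localCohomology (qv K V) i).obj (ModuleCat.of (MvPolynomial σ K) (MvPolynomial σ K ⧸ p)))}))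
    obtain ⟨B, rfl⟩ := ass_mon I hI p hp
    refine ⟨B, hp, ?_⟩
    rw [← qv_cohDim (K := K) V B]
    exact hpk
  -- lower bound
  have hlow : ∀ J : Ideal (MvPolynomial σ K), Mon J → qv K V ≤ J → ∀ i < k0,
      Subsingleton (EX (MvPolynomial σ K) (MvPolynomial σ K ⧸ J) (MvPolynomial σ K ⧸ I) i) := by
    refine mon_ind _ ?_ ?_ ?_
    · intro _ i _
      refine subsingleton_of_forall_eq 0 fun e => ?_
      have h1 : ∀ a : MvPolynomial σ K ⧸ (⊤ : Ideal (MvPolynomial σ K)), (1 : MvPolynomial σ K) • a = 0 := fun a =>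
        (Ideal.Quotient.subsingleton_iff.2 rfl : Subsingleton (MvPolynomial σ K ⧸ (⊤ : Ideal (MvPolynomial σ K)))).elim _ _
      have := EX.smul_eq_zero_left 1 h1 e
      rwa [one_smul] at this
    · intro A ih hVA i hi
      have hVA' : V ⊆ A := fun v hv => X_mem_qv.1 (hVA (X_mem_qv.2 hv))
      by_cases hIA : I ≤ qv K A
      · have := qv_prime (K := K) A
        obtain ⟨p, hp, hpA⟩ := Ideal.exists_minimalPrimes_le hIA
        have hp' : p ∈ associatedPrimes (MvPolynomial σ K) (MvPolynomial σ K ⧸ I) := by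
          apply Module.associatedPrimes.minimalPrimes_annihilator_subset_associatedPrimes
          rwa [Ideal.annihilator_quotient]
        obtain ⟨B, rfl⟩ := ass_mon I hI p hp'
        have hBA : B ⊆ A := fun v hv => X_mem_qv.1 (hpA (X_mem_qv.2 hv))
        apply hExt
        have e1 := hB B hp'
        have e2 := hle B hp'
        have e3 : Aᶜ.card + (V \ B).card ≤ Bᶜ.card := by
          rw [← Finset.card_union_of_disjoint]
          · apply Finset.card_le_card
            intro x hx
            simp at hx ⊢
            rcases hx with hx | hx
            · exact fun h => hx (hBA h)
            · exact hx.2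
          · rw [Finset.disjoint_left]
            intro x hx hx'
            simp at hx hx'
            exact hx (hVA' hx'.1)
        omega
      · obtain ⟨f, hf, hfA⟩ := SetLike.not_le_iff_exists.1 hIA
        obtain ⟨u, hu, huA⟩ : ∃ u ∈ f.support, monomial u (1:K) ∉ qv K A := by
          by_contra! h
          exact hfA (mem_of_mons h)
        have huI := hI f hf u hu
        have hu0 : ∀ a ∈ A, u a = 0 := by
          intro a ha
          by_contra h
          apply huA
          rw [mem_qv]
          intro d hd
          have := support_monomial_subset hd
          rw [Finset.mem_singleton] at this
          exact ⟨a, ha, this ▸ h⟩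
        have hses := ses_reg (fun _ h => monomial_mul_mem_qv (K := K) hu0 h) rfl le_sup_left
        have hs := ih (qv K A ⊔ Ideal.span {monomial u 1}) (mon_sup (mon_qv A) (mon_mono u))
          (lt_of_le_of_ne le_sup_left fun h => huA (by
            rw [h]; exact Ideal.mem_sup_right (Ideal.mem_span_singleton_self _))) (hVA.trans le_sup_left) i hi
        refine subsingleton_of_forall_eq 0 fun e => ?_
        have he : EX.pre ((monomial u (1:K)) • LinearMap.id) e = 0 := by
          rw [EX.pre_smul]
          apply EX.smul_eq_zero_right
          intro a
          obtain ⟨g, rfl⟩ := Ideal.Quotient.mk_surjective a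
          rw [smul_mk, Ideal.Quotient.eq_zero_iff_mem]
          exact I.mul_mem_right _ huI
        obtain ⟨e', rfl⟩ := EX.con₂ hses e he
        rw [Subsingleton.elim e' 0, map_zero]
    · intro J x hJ h1 h2 hVJ i hi
      exact EX.vanish_mid (ses_colon (mem_colonX (x := x) (J := J))) (h1 (hVJ.trans (le_colonX x J)) i hi)
        (h2 (hVJ.trans le_sup_left) i hi)
  -- upper bound
  have hup : ∃ i ≤ k0, Nontrivial (EX (MvPolynomial σ K) (MvPolynomial σ K ⧸ qv K V) (MvPolynomial σ K ⧸ I) i) := by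
    by_contra! hc
    have hadd : ∀ W : Finset σ, ∀ i ≤ k0, Subsingleton (EX (MvPolynomial σ K) (MvPolynomial σ K ⧸ qv K (W ∪ V)) (MvPolynomial σ K ⧸ I) i) := by
      intro W
      induction W using Finset.induction_on with
      | empty =>
        intro i hi
        rw [Finset.empty_union]
        exact hc i hi
      | insert x W hx ih =>
        intro i hi
        rw [Finset.insert_union]
        by_cases hxW : x ∈ W ∪ V
        · rw [Finset.insert_eq_of_mem hxW]; exact ih i hi
        · cases i with
          | zero => exact EX.vanish_right_zero (ses_qv (K := K) hxW) (ih 0 hi)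
          | succ i => exact EX.vanish_right (ses_qv (K := K) hxW) (ih i (by omega)) (ih (i+1) hi)
    refine ass_hom hB0 (nak_ext_union hI (B := V \ B0) Finset.disjoint_sdiff ?_)
    rw [Finset.union_sdiff_self_eq_union, hB0k, zero_add]
    exact hadd B0 k0 le_rfl
  obtain ⟨i, hik, hi⟩ := hup
  apply le_antisymm
  · exact (Nat.sInf_le (show i ∈ {i : ℕ | Nontrivial (EX (MvPolynomial σ K) (MvPolynomial σ K ⧸ qv K V) (MvPolynomial σ K ⧸ I) i)} from hi)).trans hik
  · refine le_csInf ⟨i, hi⟩ fun j hj => ?_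
    by_contra hlt
    have := hlow (qv K V) (mon_qv V) le_rfl j (by omega)
    exact not_subsingleton_iff_nontrivial.2 hj this
end core


theorem cohenMacaulay_monomial_quotient_maximalDepth
    (K : Type) [Field K] (m n : ℕ) (I : Ideal (BGS K m n))
    (hI : IsMonomialIdeal K m n I)
    (hCM : (extGrade (BGS K m n) (Ideal.span (Set.range (X : Fin m ⊕ Fin n → BGS K m n)))
        (BGS K m n ⧸ I) : WithBot ℕ∞) = ringKrullDim (BGS K m n ⧸ I)) :
    HasMaximalDepth (BGS K m n) (idealP K m n) (BGS K m n ⧸ I) ∧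
    HasMaximalDepth (BGS K m n) (idealQ K m n) (BGS K m n ⧸ I) := by
  have hMon : Mon I := by
    obtain ⟨T, rfl⟩ := hI
    exact mon_span T
  have hU : Ideal.span (Set.range (X : Fin m ⊕ Fin n → BGS K m n)) = qv K Finset.univ := by
    rw [qv]; simp
  have hP : idealP K m n = qv K (Finset.univ.image Sum.inl) := by
    rw [qv, idealP]
    congr 1
    ext f; simp
  have hQ : idealQ K m n = qv K (Finset.univ.image Sum.inr) := by
    rw [qv, idealQ]
    congr 1
    ext f; simp
  have hE : ∀ i < extGrade (BGS K m n) (Ideal.span (Set.range (X : Fin m ⊕ Fin n → BGS K m n))) (BGS K m n ⧸ I),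
      Subsingleton (EX (BGS K m n) (BGS K m n ⧸ qv K (Finset.univ : Finset (Fin m ⊕ Fin n))) (BGS K m n ⧸ I) i) := by
    intro i hi
    rw [extGrade, extGrade_eq, hU] at hi
    exact not_nontrivial_iff_subsingleton.1 (Nat.notMem_of_lt_sInf hi)
  have key := core hMon _ hCM hE
  constructor
  · rw [HasMaximalDepth, extGrade, extGrade_eq, mCohDim, hP]
    exact key _
  · rw [HasMaximalDepth, extGrade, extGrade_eq, mCohDim, hQ]
    exact key _
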